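/- Let n ≥ 1, 0 < p ≤ 1, α > −1, λ = (α+n+1)/p, and let m ∈ ℕ₀ satisfy m > max(λ − 1, α/p). For f ∈ A_λ^∞(ℝ^{n+1}_+) set d₁(f) = inf{ ‖f − g‖_{A_λ^∞} : g ∈ A_α^p } and d₂(f) = inf{ ε > 0 : ∫_{ℝ^{n+1}_+} ( ∫_{V_{ε,λ}(f)} |Q_m(z,w)| s^{m−λ} dy ds )^p t^α dx dt < ∞ }, where V_{ε,λ}(f) = {(y,s) ∈ ℝ^{n+1}_+ : |f(y,s)| s^λ ≥ ε} and the infimum of the empty set is +∞. Then there exist constants c, C > 0, independent of f, such that c·d₂(f) ≤ d₁(f) ≤ C·d₂(f) for every f ∈ A_λ^∞. -/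

import Mathlib

open MeasureTheory Real Set
open scoped ENNReal

noncomputable section

abbrev Euc (N : ℕ) : Type := EuclideanSpace ℝ (Fin N)

/-- The point `(x, t) ∈ ℝ^{n+1}`. -/
def pt {n : ℕ} (x : Euc n) (t : ℝ) : Euc (n + 1) :=
  (EuclideanSpace.equiv (Fin (n + 1)) ℝ).symm (Fin.snoc (fun i => x i) t)

/-- horizontal part of a point of ℝ^{n+1} -/
def xp {n : ℕ} (z : Euc (n + 1)) : Euc n :=
  (EuclideanSpace.equiv (Fin n) ℝ).symm (fun i => z i.castSucc)

/-- vertical part of a point of ℝ^{n+1} -/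
def tp {n : ℕ} (z : Euc (n + 1)) : ℝ := z (Fin.last n)

/-- The upper half space ℝ^{n+1}_+. -/
def upperHS (n : ℕ) : Set (Euc (n + 1)) := {z | 0 < tp z}

/-- |z - w̄| where z = (x,t), w̄ = (y, -s): Euclidean distance -/
def dB {n : ℕ} (x : Euc n) (t : ℝ) (y : Euc n) (s : ℝ) : ℝ :=
  dist (pt x t) (pt y (-s))

/-- the measure t^λ dx dt on ℝ^n × (0,∞), identified with ℝ^{n+1}_+ -/
def mLam (n : ℕ) (l : ℝ) : Measure (Euc n × ℝ) :=
  ((volume : Measure (Euc n)).prod ((volume : Measure ℝ).restrict (Ioi 0))).withDensity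
    (fun zt => ENNReal.ofReal (zt.2 ^ l))

/-- second derivative of `f` at `z` along direction `v` -/
def d2 {V : Type*} [NormedAddCommGroup V] [NormedSpace ℝ V] (f : V → ℝ) (z v : V) : ℝ :=
  iteratedFDeriv ℝ 2 f z ![v, v]

/-- `f` is harmonic on a subset of ℝ^N : twice continuously differentiable with
vanishing Laplacian. -/
def HarmonicOnE {N : ℕ} (f : Euc N → ℝ) (s : Set (Euc N)) : Prop :=
  ContDiffOn ℝ 2 f s ∧ ∀ z ∈ s, ∑ i, d2 f z (EuclideanSpace.single i 1) = 0

/-- `f` is harmonic on (ℝ^{n+1}_+)^m, viewed as an open subset of ℝ^{m(n+1)}. -/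
def HarmonicOnM {n m : ℕ} (f : (Fin m → Euc (n + 1)) → ℝ) : Prop :=
  ContDiffOn ℝ 2 f {z | ∀ j, z j ∈ upperHS n} ∧
  ∀ z ∈ {z : Fin m → Euc (n + 1) | ∀ j, z j ∈ upperHS n},
    ∑ j, ∑ i, d2 f z (Function.update (0 : Fin m → Euc (n + 1)) j (EuclideanSpace.single i 1)) = 0

/-- `f` is harmonic in each variable separately on (ℝ^{n+1}_+)^m -/
def HarmonicSep {n m : ℕ} (f : (Fin m → Euc (n + 1)) → ℝ) : Prop :=
  ∀ (j : Fin m) (z : Fin m → Euc (n + 1)), (∀ k, z k ∈ upperHS n) →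
    HarmonicOnE (fun w => f (Function.update z j w)) (upperHS n)

/-- the closed cube centered at (y,s) with side length s -/
def Qcube {n : ℕ} (y : Euc n) (s : ℝ) : Set (Euc (n + 1)) :=
  {z | (∀ i : Fin n, |z (Fin.castSucc i) - y i| ≤ s / 2) ∧ |tp z - s| ≤ s / 2}

/-- the A^p_λ (quasi)-norm, raised to the power p -/
def normAp (n : ℕ) (f : Euc (n + 1) → ℝ) (p l : ℝ) : ℝ≥0∞ :=
  ∫⁻ zt : Euc n × ℝ, ENNReal.ofReal (|f (pt zt.1 zt.2)| ^ p) ∂(mLam n l)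

/-- membership in the harmonic Bergman space A^p_λ -/
def memAp (n : ℕ) (f : Euc (n + 1) → ℝ) (p l : ℝ) : Prop :=
  HarmonicOnE f (upperHS n) ∧ normAp n f p l < ⊤


/-- the A^∞_λ norm sup_{(x,t)} t^λ |f(x,t)|, as an extended real -/
def supNormE (n : ℕ) (f : Euc (n + 1) → ℝ) (l : ℝ) : ℝ≥0∞ :=
  ⨆ (v : Euc n × ℝ) (_ : 0 < v.2), ENNReal.ofReal (v.2 ^ l * |f (pt v.1 v.2)|)

/-- the standard normalizing constant of the Poisson kernel for ℝ^{n+1}_+ -/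
def cP (n : ℕ) : ℝ := Real.Gamma (((n : ℝ) + 1) / 2) / Real.pi ^ (((n : ℝ) + 1) / 2)

/-- the Poisson kernel P(x,t) = c_n t (|x|² + t²)^{-(n+1)/2} for ℝ^{n+1}_+ -/
def Pker (n : ℕ) (x : Euc n) (t : ℝ) : ℝ :=
  cP n * t / (‖x‖ ^ 2 + t ^ 2) ^ (((n : ℝ) + 1) / 2)

/-- the harmonic Bergman kernel Q_m(z,w), z = (x,t), w = (y,s) -/
def Qker (n m : ℕ) (x : Euc n) (t : ℝ) (y : Euc n) (s : ℝ) : ℝ :=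
  ((-2 : ℝ) ^ (m + 1) / (Nat.factorial m : ℝ)) *
    iteratedDeriv (m + 1) (fun u => Pker n (x - y) u) (t + s)

/-- d₁(f): the distance from f to A^p_α, measured in the A^∞_λ norm -/
def distOne (n : ℕ) (p α lam : ℝ) (f : Euc (n + 1) → ℝ) : ℝ≥0∞ :=
  ⨅ (g : Euc (n + 1) → ℝ) (_ : memAp n g p α), supNormE n (fun z => f z - g z) lam

/-- the level set V_{ε,λ}(f) = {(y,s) : |f(y,s)| s^λ ≥ ε} -/
def Vset (n : ℕ) (f : Euc (n + 1) → ℝ) (lam ε : ℝ) : Set (Euc n × ℝ) :=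
  {v | 0 < v.2 ∧ ε ≤ |f (pt v.1 v.2)| * v.2 ^ lam}

/-- the quantity ∫_{ℝ^{n+1}_+} ( ∫_{V_{ε,λ}} |Q_m(z,w)| s^{m-λ} dy ds )^p t^α dx dt -/
def distTwoInt (n m : ℕ) (f : Euc (n + 1) → ℝ) (lam α p ε : ℝ) : ℝ≥0∞ :=
  ∫⁻ z : Euc n × ℝ in univ ×ˢ Ioi (0 : ℝ),
    ((∫⁻ w : Euc n × ℝ in Vset n f lam ε,
        ENNReal.ofReal (|Qker n m z.1 z.2 w.1 w.2| * w.2 ^ ((m : ℝ) - lam))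
        ∂((volume : Measure (Euc n)).prod (volume : Measure ℝ))) ^ p)
      * ENNReal.ofReal (z.2 ^ α)
    ∂((volume : Measure (Euc n)).prod (volume : Measure ℝ))

/-- d₂(f); the infimum over the empty set is +∞ -/
def distTwo (n m : ℕ) (f : Euc (n + 1) → ℝ) (lam α p : ℝ) : ℝ≥0∞ :=
  ⨅ (ε : ℝ) (_ : 0 < ε ∧ distTwoInt n m f lam α p ε < ⊤), ENNReal.ofReal ε

section Coordinates
variable {n : ℕ}

@[simp] lemma pt_castSucc (x : Euc n) (t : ℝ) (i : Fin n) : pt x t i.castSucc = x i := by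
  simp [pt]

@[simp] lemma pt_last (x : Euc n) (t : ℝ) : pt x t (Fin.last n) = t := by
  simp [pt]

@[simp] lemma tp_pt (x : Euc n) (t : ℝ) : tp (pt x t) = t := by
  simp [tp]

@[simp] lemma xp_apply (z : Euc (n + 1)) (i : Fin n) : xp z i = z i.castSucc := rfl

@[simp] lemma pt_xp_tp (z : Euc (n + 1)) : pt (xp z) (tp z) = z := by
  ext i
  refine Fin.lastCases ?_ (fun i => ?_) i <;> simp [tp]

lemma pt_sub (x y : Euc n) (t s : ℝ) : pt x t - pt y s = pt (x - y) (t - s) := by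
  ext i
  refine Fin.lastCases ?_ (fun i => ?_) i <;> simp

lemma pt_add (x y : Euc n) (t s : ℝ) : pt x t + pt y s = pt (x + y) (t + s) := by
  ext i
  refine Fin.lastCases ?_ (fun i => ?_) i <;> simp

lemma smul_pt (r : ℝ) (x : Euc n) (t : ℝ) : r • pt x t = pt (r • x) (r * t) := by
  ext i
  refine Fin.lastCases ?_ (fun i => ?_) i <;> simp

lemma norm_pt_sq (x : Euc n) (t : ℝ) : ‖pt x t‖ ^ 2 = ‖x‖ ^ 2 + t ^ 2 := by
  simp [EuclideanSpace.norm_sq_eq, Fin.sum_univ_castSucc]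

lemma norm_le_norm_pt (x : Euc n) (t : ℝ) : ‖x‖ ≤ ‖pt x t‖ := by
  refine abs_le_of_sq_le_sq' ?_ (norm_nonneg _) |>.2
  rw [norm_pt_sq]; nlinarith [sq_nonneg t]

lemma abs_tp_le_norm (z : Euc (n + 1)) : |tp z| ≤ ‖z‖ := by
  simpa [tp] using PiLp.norm_apply_le z (Fin.last n)

lemma tp_sub (z w : Euc (n + 1)) : tp (z - w) = tp z - tp w := rfl
lemma tp_add (z w : Euc (n + 1)) : tp (z + w) = tp z + tp w := rfl
lemma tp_smul (r : ℝ) (w : Euc (n + 1)) : tp (r • w) = r * tp w := rfl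

lemma contDiff_tp {k : WithTop ℕ∞} : ContDiff ℝ k (tp : Euc (n + 1) → ℝ) :=
  (EuclideanSpace.proj (𝕜 := ℝ) (Fin.last n) : Euc (n + 1) →L[ℝ] ℝ).contDiff

@[fun_prop] lemma continuous_tp : Continuous (tp : Euc (n + 1) → ℝ) :=
  (contDiff_tp (k := 0)).continuous

@[fun_prop] lemma continuous_xp : Continuous (xp : Euc (n + 1) → Euc n) := by
  unfold xp; fun_prop

lemma continuous_pt : Continuous (fun v : Euc n × ℝ => pt v.1 v.2) := by
  unfold pt
  refine (EuclideanSpace.equiv (Fin (n + 1)) ℝ).symm.continuous.comp ?_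
  refine continuous_pi fun i => ?_
  refine Fin.lastCases ?_ (fun i => ?_) i <;> simp <;> fun_prop

@[fun_prop] lemma Continuous.pt' {Y : Type*} [TopologicalSpace Y] {a : Y → Euc n} {b : Y → ℝ}
    (ha : Continuous a) (hb : Continuous b) : Continuous (fun y => pt (a y) (b y)) :=
  continuous_pt.comp (ha.prodMk hb)

lemma isOpen_upperHS : IsOpen (upperHS n) := isOpen_lt continuous_const continuous_tp

lemma pt_mem_upperHS {x : Euc n} {t : ℝ} : pt x t ∈ upperHS n ↔ 0 < t := by
  simp [upperHS]

lemma ne_zero_of_tp_pos {z : Euc (n + 1)} (h : 0 < tp z) : z ≠ 0 := by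
  rintro rfl; simp [tp] at h

lemma pt_add_smul (x : Euc n) (t u : ℝ) : pt x (t + u) = pt x t + u • pt 0 1 := by
  rw [smul_pt, pt_add]; simp

lemma hasDerivAt_pt (x : Euc n) (t : ℝ) : HasDerivAt (fun u => pt x u) (pt 0 1) t := by
  have h : (fun u : ℝ => pt x u) = fun u => pt x 0 + u • (pt 0 1 : Euc (n + 1)) := by
    funext u; rw [← pt_add_smul, zero_add]
  rw [h]
  simpa using ((hasDerivAt_id t).smul_const (pt 0 1 : Euc (n + 1))).const_add (pt x 0)

end Coordinates

section SecondDerivative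

lemma two_le_coe_top : (2 : WithTop ℕ∞) ≤ ((⊤ : ℕ∞) : WithTop ℕ∞) :=
  WithTop.coe_le_coe.2 (le_top : (2 : ℕ∞) ≤ ⊤)

lemma d2_eq_fderiv {V : Type*} [NormedAddCommGroup V] [NormedSpace ℝ V] (f : V → ℝ) (z v : V) :
    d2 f z v = fderiv ℝ (fderiv ℝ f) z v v := by
  simp [d2, iteratedFDeriv_two_apply]

lemma d2_congr {V : Type*} [NormedAddCommGroup V] [NormedSpace ℝ V] {f g : V → ℝ} {z : V}
    (h : f =ᶠ[nhds z] g) (v : V) : d2 f z v = d2 g z v := by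
  rw [d2_eq_fderiv, d2_eq_fderiv, h.fderiv.fderiv_eq]

lemma HarmonicOnE.congr {N : ℕ} {f g : Euc N → ℝ} {s : Set (Euc N)} (hs : IsOpen s)
    (hf : HarmonicOnE f s) (h : ∀ z ∈ s, g z = f z) : HarmonicOnE g s := by
  refine ⟨hf.1.congr h, fun z hz => ?_⟩
  rw [← hf.2 z hz]
  refine Finset.sum_congr rfl fun i _ => d2_congr ?_ _
  filter_upwards [hs.mem_nhds hz] with w hw using h w hw

lemma differentiableAt_fderiv_of_contDiffAt {V F : Type*} [NormedAddCommGroup V] [NormedSpace ℝ V]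
    [NormedAddCommGroup F] [NormedSpace ℝ F] {f : V → F} {z : V}
    (hf : ContDiffAt ℝ 2 f z) : DifferentiableAt ℝ (fderiv ℝ f) z :=
  (hf.fderiv_right (m := 1) (by norm_num)).differentiableAt (by norm_num)

/-- second derivatives of linear combinations -/
lemma d2_linear_comb {V : Type*} [NormedAddCommGroup V] [NormedSpace ℝ V] {f g : V → ℝ} {z : V}
    (hf : ContDiffAt ℝ 2 f z) (hg : ContDiffAt ℝ 2 g z) (a b : ℝ) (v : V) :
    d2 (fun w => a * f w + b * g w) z v = a * d2 f z v + b * d2 g z v := by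
  have h1 : fderiv ℝ (fun w => a * f w + b * g w) =ᶠ[nhds z]
      fun w => a • fderiv ℝ f w + b • fderiv ℝ g w := by
    filter_upwards [hf.eventually (by simp), hg.eventually (by simp)] with w hw hw'
    have hfw := hw.differentiableAt (by norm_num)
    have hgw := hw'.differentiableAt (by norm_num)
    exact ((hfw.hasFDerivAt.const_mul a).add (hgw.hasFDerivAt.const_mul b)).fderiv
  simp only [d2_eq_fderiv]
  rw [h1.fderiv_eq]
  have h2 := ((differentiableAt_fderiv_of_contDiffAt hf).hasFDerivAt.const_smul a).add
    ((differentiableAt_fderiv_of_contDiffAt hg).hasFDerivAt.const_smul b)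
  have h3 := h2.fderiv
  erw [h3]
  simp

lemma HarmonicOnE.linear_comb {N : ℕ} {f g : Euc N → ℝ} {s : Set (Euc N)} (hs : IsOpen s)
    (hf : HarmonicOnE f s) (hg : HarmonicOnE g s) (a b : ℝ) :
    HarmonicOnE (fun z => a * f z + b * g z) s := by
  refine ⟨(contDiffOn_const.mul hf.1).add (contDiffOn_const.mul hg.1), fun z hz => ?_⟩
  have h1 := hf.1.contDiffAt (hs.mem_nhds hz)
  have h2 := hg.1.contDiffAt (hs.mem_nhds hz)
  simp_rw [d2_linear_comb h1 h2, Finset.sum_add_distrib, ← Finset.mul_sum, hf.2 z hz, hg.2 z hz]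
  simp

lemma HarmonicOnE.mono {N : ℕ} {f : Euc N → ℝ} {s t : Set (Euc N)}
    (hf : HarmonicOnE f s) (h : t ⊆ s) : HarmonicOnE f t :=
  ⟨hf.1.mono h, fun z hz => hf.2 z (h hz)⟩

lemma HarmonicOnE.comp_add_right {N : ℕ} {f : Euc N → ℝ} {s : Set (Euc N)}
    (hf : HarmonicOnE f s) (c : Euc N) :
    HarmonicOnE (fun z => f (z + c)) {z | z + c ∈ s} := by
  refine ⟨hf.1.comp (contDiff_id.add contDiff_const).contDiffOn fun z hz => hz, fun z hz => ?_⟩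
  rw [← hf.2 (z + c) hz]
  refine Finset.sum_congr rfl fun i _ => ?_
  have h1 : fderiv ℝ (fun z => f (z + c)) = fun z => fderiv ℝ f (z + c) := by
    funext w; exact fderiv_comp_add_right c
  rw [d2_eq_fderiv, d2_eq_fderiv, h1, fderiv_comp_add_right]

/-- If `f` is harmonic and smooth then so are its directional derivatives. -/
lemma HarmonicOnE.fderiv_apply {N : ℕ} {f : Euc N → ℝ} {s : Set (Euc N)} (hs : IsOpen s)
    (hf : HarmonicOnE f s) (hf' : ContDiffOn ℝ (⊤ : ℕ∞) f s) (v : Euc N) :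
    HarmonicOnE (fun z => fderiv ℝ f z v) s := by
  have hD : ContDiffOn ℝ (⊤ : ℕ∞) (fderiv ℝ f) s := hf'.fderiv_of_isOpen hs (by simp)
  have hDD : ContDiffOn ℝ (⊤ : ℕ∞) (fderiv ℝ (fderiv ℝ f)) s := hD.fderiv_of_isOpen hs (by simp)
  have hDv : ∀ u, ContDiffOn ℝ (⊤ : ℕ∞) (fun z => fderiv ℝ f z u) s := fun u =>
    hD.clm_apply contDiffOn_const
  refine ⟨(hDv v).of_le two_le_coe_top, fun z hz => ?_⟩
  have key : ∀ e, d2 (fun z => fderiv ℝ f z v) z e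
      = fderiv ℝ (fun w => d2 f w e) z v := by
    intro e
    have hsym : ∀ w ∈ s, ∀ a b, fderiv ℝ (fun z => fderiv ℝ f z a) w b
        = fderiv ℝ (fun z => fderiv ℝ f z b) w a := by
      intro w hw a b
      have hd : DifferentiableAt ℝ (fderiv ℝ f) w :=
        (hD.contDiffAt (hs.mem_nhds hw)).differentiableAt (by simp)
      rw [fderiv_clm_apply hd (by fun_prop), fderiv_clm_apply hd (by fun_prop)]
      have := (hf'.contDiffAt (hs.mem_nhds hw)).isSymmSndFDerivAt
        (by simpa using two_le_coe_top)
      simpa using this b a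
    have hsym2 : ∀ a b, fderiv ℝ (fun w => fderiv ℝ (fun z => fderiv ℝ f z e) w a) z b
        = fderiv ℝ (fun w => fderiv ℝ (fun z => fderiv ℝ f z e) w b) z a := by
      intro a b
      have hd : DifferentiableAt ℝ (fderiv ℝ (fun z => fderiv ℝ f z e)) z :=
        (((hDv e).fderiv_of_isOpen hs (m := (⊤ : ℕ∞)) (by simp)).contDiffAt
          (hs.mem_nhds hz)).differentiableAt (by simp)
      rw [fderiv_clm_apply hd (by fun_prop), fderiv_clm_apply hd (by fun_prop)]
      have := ((hDv e).contDiffAt (hs.mem_nhds hz)).isSymmSndFDerivAt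
        (by simpa using two_le_coe_top)
      simpa using this b a
    have e1 : ∀ (g : Euc N → ℝ), ContDiffOn ℝ (⊤ : ℕ∞) g s → ∀ w ∈ s,
        d2 g w e = fderiv ℝ (fun z => fderiv ℝ g z e) w e := by
      intro g hg w hw
      have hd : DifferentiableAt ℝ (fderiv ℝ g) w :=
        ((hg.fderiv_of_isOpen hs (m := (⊤ : ℕ∞)) (by simp)).contDiffAt
          (hs.mem_nhds hw)).differentiableAt (by simp)
      rw [d2_eq_fderiv, fderiv_clm_apply hd (by fun_prop)]
      simp
    rw [e1 _ (hDv v) z hz]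
    have e2 : (fun w => d2 f w e) =ᶠ[nhds z] fun w => fderiv ℝ (fun z => fderiv ℝ f z e) w e := by
      filter_upwards [hs.mem_nhds hz] with w hw using e1 f hf' w hw
    rw [e2.fderiv_eq, ← hsym2 v e]
    refine congrFun (congrArg DFunLike.coe (Filter.EventuallyEq.fderiv_eq ?_)) e
    filter_upwards [hs.mem_nhds hz] with w hw using hsym w hw v e
  simp_rw [key]
  have hdiff : ∀ i : Fin N, DifferentiableAt ℝ
      (fun w => d2 f w (EuclideanSpace.single i 1)) z := by
    intro i
    simp_rw [d2_eq_fderiv]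
    exact ((((hDD.clm_apply contDiffOn_const).clm_apply contDiffOn_const)).contDiffAt
          (hs.mem_nhds hz)).differentiableAt (n := (⊤ : ℕ∞)) (by simp)
  have hsum := fderiv_fun_sum (𝕜 := ℝ) (u := Finset.univ) (fun i _ => hdiff i)
  have hzero : (fun w => ∑ i, d2 f w (EuclideanSpace.single i 1)) =ᶠ[nhds z] fun _ => (0 : ℝ) := by
    filter_upwards [hs.mem_nhds hz] with w hw using hf.2 w hw
  rw [hzero.fderiv_eq] at hsum
  have := congrArg (fun L => L v) hsum
  simpa using this.symm

end SecondDerivative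

section Homogeneous

/-- smooth away from the origin and positively homogeneous of degree `-d` -/
structure IsHomog {E F : Type*} [NormedAddCommGroup E] [NormedSpace ℝ E]
    [NormedAddCommGroup F] [NormedSpace ℝ F] (d : ℝ) (k : E → F) : Prop where
  smooth : ContDiffOn ℝ (⊤ : ℕ∞) k {0}ᶜ
  homog : ∀ r : ℝ, 0 < r → ∀ z, k (r • z) = r ^ (-d) • k z

variable {E F G : Type*} [NormedAddCommGroup E] [NormedSpace ℝ E]
    [NormedAddCommGroup F] [NormedSpace ℝ F] [NormedAddCommGroup G] [NormedSpace ℝ G]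
    {d : ℝ} {k : E → F}

lemma IsHomog.fderiv (h : IsHomog d k) : IsHomog (d + 1) (fderiv ℝ k) := by
  refine ⟨h.smooth.fderiv_of_isOpen isOpen_compl_singleton (by simp), fun r hr z => ?_⟩
  have h1 : (fun z => k (r • z)) = r ^ (-d) • k := funext fun z => h.homog r hr z
  have h2 := fderiv_comp_smul (𝕜 := ℝ) (f := k) (x := z) r
  rw [h1] at h2
  rw [fderiv_const_smul_field] at h2
  rw [neg_add, rpow_add hr, mul_comm, mul_smul]
  simp only [Pi.smul_apply] at h2
  rw [h2, rpow_neg hr.le, rpow_one, smul_smul, inv_mul_cancel₀ hr.ne', one_smul]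

lemma IsHomog.clm_comp (h : IsHomog d k) (L : F →L[ℝ] G) : IsHomog d (fun z => L (k z)) :=
  ⟨L.contDiff.comp_contDiffOn h.smooth, fun r hr z => by simp [h.homog r hr z]⟩

lemma IsHomog.bound [FiniteDimensional ℝ E] (h : IsHomog d k) :
    ∃ C : ℝ, 0 ≤ C ∧ ∀ z ≠ 0, ‖k z‖ ≤ C * ‖z‖ ^ (-d) := by
  have hc : ContinuousOn k (Metric.sphere 0 1) :=
    h.smooth.continuousOn.mono fun z hz h0 => by
      rw [mem_singleton_iff] at h0; simp [h0] at hz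
  have : ProperSpace E := FiniteDimensional.proper ℝ E
  obtain ⟨C, hC⟩ := (isCompact_sphere (0 : E) 1).exists_bound_of_continuousOn hc
  refine ⟨max C 0, le_max_right _ _, fun z hz => ?_⟩
  have hz' : 0 < ‖z‖ := norm_pos_iff.2 hz
  have h1 : k z = ‖z‖ ^ (-d) • k (‖z‖⁻¹ • z) := by
    rw [← h.homog _ hz', smul_smul, mul_inv_cancel₀ hz'.ne', one_smul]
  rw [h1, norm_smul, mul_comm, Real.norm_of_nonneg (by positivity)]
  gcongr
  refine (hC _ ?_).trans (le_max_left _ _)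
  simp [norm_smul, hz'.ne']

lemma IsHomog.measurable [FiniteDimensional ℝ E] [MeasurableSpace E] [BorelSpace E]
    [MeasurableSpace F] [BorelSpace F] (h : IsHomog d k) : Measurable k :=
  measurable_of_continuousOn_compl_singleton 0 h.smooth.continuousOn

end Homogeneous

section Poisson
variable {n : ℕ}

lemma cP_pos (n : ℕ) : 0 < cP n := by
  unfold cP
  have := Real.Gamma_pos_of_pos (s := ((n : ℝ) + 1) / 2) (by positivity)
  positivity

/-- the Poisson kernel as a function on `ℝ^{n+1}` -/
def poissonFun (n : ℕ) (z : Euc (n + 1)) : ℝ :=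
  cP n * tp z * (‖z‖ ^ 2) ^ (-(((n : ℝ) + 1) / 2))

lemma Pker_eq (x : Euc n) (t : ℝ) : Pker n x t = poissonFun n (pt x t) := by
  rw [Pker, poissonFun, norm_pt_sq, rpow_neg (by positivity), tp_pt, div_eq_mul_inv]

lemma isHomog_poissonFun (n : ℕ) : IsHomog (n : ℝ) (poissonFun n) := by
  refine ⟨?_, fun r hr z => ?_⟩
  · unfold poissonFun
    refine (contDiffOn_const.mul contDiff_tp.contDiffOn).mul ?_
    refine ContDiffOn.rpow_const_of_ne (contDiff_norm_sq ℝ).contDiffOn fun z hz => ?_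
    have : z ≠ 0 := hz
    positivity
  · unfold poissonFun
    rw [tp_smul, norm_smul, Real.norm_of_nonneg hr.le, mul_pow, mul_rpow (by positivity)
      (by positivity), ← rpow_natCast r 2, ← rpow_mul hr.le, smul_eq_mul]
    have : r ^ (-(n : ℝ)) = r * r ^ (((2 : ℕ) : ℝ) * -(((n : ℝ) + 1) / 2)) := by
      nth_rw 2 [← rpow_one r]
      rw [← rpow_add hr]; congr 1; push_cast; ring
    rw [this]; ring

lemma hasFDerivAt_normSq_rpow {N : ℕ} (s : ℝ) {z : Euc N} (hz : z ≠ 0) :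
    HasFDerivAt (fun z : Euc N => (‖z‖ ^ 2) ^ s)
      ((s * (‖z‖ ^ 2) ^ (s - 1)) • ((2 : ℝ) • innerSL ℝ z)) z := by
  have h := (hasStrictFDerivAt_norm_sq z).hasFDerivAt
  have h2 := h.rpow_const (p := s) (Or.inl (by positivity))
  have e : (2 : ℝ) • innerSL ℝ z = (2 : ℕ) • innerSL ℝ z := by rw [two_smul, two_nsmul]
  rw [e]
  exact h2

lemma harmonic_poissonFun (n : ℕ) : HarmonicOnE (poissonFun n) {0}ᶜ := by
  refine ⟨(isHomog_poissonFun n).smooth.of_le two_le_coe_top, fun z hz => ?_⟩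
  set q : ℝ := -(((n : ℝ) + 1) / 2) with hq
  have htp : ∀ z : Euc (n + 1), HasFDerivAt tp
      (EuclideanSpace.proj (𝕜 := ℝ) (Fin.last n) : Euc (n + 1) →L[ℝ] ℝ) z := fun z =>
    (EuclideanSpace.proj (𝕜 := ℝ) (Fin.last n) : Euc (n + 1) →L[ℝ] ℝ).hasFDerivAt
  have h1 : ∀ w : Euc (n + 1), w ≠ 0 → ∀ v, fderiv ℝ (poissonFun n) w v
      = cP n * (tp v * (‖w‖ ^ 2) ^ q
        + tp w * (q * (‖w‖ ^ 2) ^ (q - 1) * (2 * innerSL ℝ v w))) := by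
    intro w hw v
    have := ((htp w).const_mul (cP n)).mul (hasFDerivAt_normSq_rpow q hw)
    have h := this.fderiv
    have e : fderiv ℝ (poissonFun n) w v = _ := congrArg (fun L => L v) h
    rw [e]
    simp [real_inner_comm]
    simp [tp]
    ring
  have h2 : ∀ v, d2 (poissonFun n) z v = cP n * (
      (tp v * (q * (‖z‖ ^ 2) ^ (q - 1) * (2 * innerSL ℝ v z))) * 2
      + tp z * (q * (((q - 1) * (‖z‖ ^ 2) ^ (q - 1 - 1) * (2 * innerSL ℝ v z))
        * (2 * innerSL ℝ v z) + (‖z‖ ^ 2) ^ (q - 1) * (2 * innerSL ℝ v v)))) := by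
    intro v
    have hd : DifferentiableAt ℝ (fderiv ℝ (poissonFun n)) z :=
      ((isHomog_poissonFun n).fderiv.smooth.contDiffAt
        (isOpen_compl_singleton.mem_nhds hz)).differentiableAt (by simp)
    have e0 : d2 (poissonFun n) z v = fderiv ℝ (fun w => fderiv ℝ (poissonFun n) w v) z v := by
      rw [d2_eq_fderiv, fderiv_clm_apply hd (by fun_prop)]; simp
    have e1 : (fun w => fderiv ℝ (poissonFun n) w v) =ᶠ[nhds z] fun w =>
        cP n * (tp v * (‖w‖ ^ 2) ^ q
        + tp w * (q * (‖w‖ ^ 2) ^ (q - 1) * (2 * innerSL ℝ v w))) := by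
      filter_upwards [isOpen_compl_singleton.mem_nhds hz] with w hw using h1 w hw v
    have hi : HasFDerivAt (fun w => innerSL ℝ v w) (innerSL ℝ v) z := (innerSL ℝ v).hasFDerivAt
    have h3 := ((((hasFDerivAt_normSq_rpow q hz).const_mul (tp v)).add
      ((htp z).mul (((hasFDerivAt_normSq_rpow (q - 1) hz).const_mul q).mul
        (hi.const_mul 2)))).const_mul (cP n)).fderiv
    rw [e0, e1.fderiv_eq]
    have e : fderiv ℝ (fun w => cP n * (tp v * (‖w‖ ^ 2) ^ q
        + tp w * (q * (‖w‖ ^ 2) ^ (q - 1) * (2 * innerSL ℝ v w)))) z v = _ :=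
      congrArg (fun L => L v) h3
    rw [e]
    simp [real_inner_comm]
    simp [tp]
    ring
  have hR : 0 < ‖z‖ ^ 2 := by have : z ≠ 0 := hz; positivity
  have s1 : ∑ i, tp (EuclideanSpace.single i (1 : ℝ) : Euc (n + 1)) * z i = tp z := by
    simp [tp]
  have s2 : ∑ i, z i * z i = ‖z‖ ^ 2 := by
    rw [EuclideanSpace.norm_sq_eq]; simp [← pow_two]
  have s3 : (‖z‖ ^ 2) ^ (q - 1) = (‖z‖ ^ 2) ^ (q - 1 - 1) * ‖z‖ ^ 2 := by
    rw [rpow_sub_one hR.ne' (q - 1), div_mul_cancel₀ _ hR.ne']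
  have h4 : ∀ i : Fin (n + 1), d2 (poissonFun n) z (EuclideanSpace.single i 1) =
      (cP n * 4 * q * (‖z‖ ^ 2) ^ (q - 1)) *
        (tp (EuclideanSpace.single i (1 : ℝ) : Euc (n + 1)) * z i)
      + (cP n * tp z * q * (q - 1) * (‖z‖ ^ 2) ^ (q - 1 - 1) * 4) * (z i * z i)
      + cP n * tp z * q * (‖z‖ ^ 2) ^ (q - 1) * 2 := by
    intro i
    rw [h2]
    simp [EuclideanSpace.inner_single_left]
    ring
  simp_rw [h4, Finset.sum_add_distrib, ← Finset.mul_sum]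
  rw [s1, s2]
  simp only [Finset.sum_const, Finset.card_univ, Fintype.card_fin, nsmul_eq_mul]
  push_cast
  rw [s3, hq]; ring

/-- iterated vertical derivatives of the Poisson kernel -/
def poissonDeriv (n : ℕ) : ℕ → Euc (n + 1) → ℝ
  | 0 => poissonFun n
  | j + 1 => fun z => fderiv ℝ (poissonDeriv n j) z (pt 0 1)

lemma isHomog_poissonDeriv (n j : ℕ) : IsHomog ((n : ℝ) + j) (poissonDeriv n j) := by
  induction j with
  | zero => rw [Nat.cast_zero, add_zero]; exact isHomog_poissonFun n
  | succ j ih =>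
    have := ih.fderiv.clm_comp (ContinuousLinearMap.apply ℝ ℝ (pt 0 1 : Euc (n + 1)))
    push_cast
    rw [← add_assoc]
    exact this

lemma harmonic_poissonDeriv (n j : ℕ) : HarmonicOnE (poissonDeriv n j) {0}ᶜ := by
  induction j with
  | zero => exact harmonic_poissonFun n
  | succ j ih =>
    exact ih.fderiv_apply isOpen_compl_singleton (isHomog_poissonDeriv n j).smooth _

lemma iteratedDeriv_Pker (x : Euc n) (j : ℕ) {t : ℝ} (ht : 0 < t) :
    iteratedDeriv j (fun u => Pker n x u) t = poissonDeriv n j (pt x t) := by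
  induction j generalizing t with
  | zero => simp [Pker_eq, poissonDeriv]
  | succ j ih =>
    rw [iteratedDeriv_succ]
    have h1 : iteratedDeriv j (fun u => Pker n x u) =ᶠ[nhds t]
        fun u => poissonDeriv n j (pt x u) := by
      filter_upwards [lt_mem_nhds ht] with u hu using ih hu
    rw [h1.deriv_eq]
    have hz : pt x t ≠ 0 := ne_zero_of_tp_pos (by simpa using ht)
    have hd : DifferentiableAt ℝ (poissonDeriv n j) (pt x t) :=
      ((isHomog_poissonDeriv n j).smooth.contDiffAt
        (isOpen_compl_singleton.mem_nhds hz)).differentiableAt (by simp)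
    exact (hd.hasFDerivAt.comp_hasDerivAt t (hasDerivAt_pt x t)).deriv

lemma Qker_eq (m : ℕ) (x y : Euc n) {t s : ℝ} (h : 0 < t + s) :
    Qker n m x t y s = ((-2 : ℝ) ^ (m + 1) / (Nat.factorial m : ℝ)) *
      poissonDeriv n (m + 1) (pt x t - pt y (-s)) := by
  rw [Qker, iteratedDeriv_Pker _ _ h, pt_sub, sub_neg_eq_add]

end Poisson

section Potential

variable {n : ℕ} {W : Type*} [MeasurableSpace W] {μ : Measure W} {a : W → ℝ}
  {b : W → Euc (n + 1)}

lemma aestronglyMeasurable_potential {F : Type} [NormedAddCommGroup F] [NormedSpace ℝ F]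
    [FiniteDimensional ℝ F] {d : ℝ} {k : Euc (n + 1) → F} (ha : AEStronglyMeasurable a μ)
    (hb : Measurable b) (hk : IsHomog d k) (z : Euc (n + 1)) :
    AEStronglyMeasurable (fun w => a w • k (z - b w)) μ := by
  borelize F
  have : ProperSpace F := FiniteDimensional.proper ℝ F
  refine ha.smul ?_
  have hm : Measurable fun w => k (z - b w) := hk.measurable.comp (measurable_const.sub hb)
  exact hm.stronglyMeasurable.aestronglyMeasurable

lemma tp_le_norm_sub {z c : Euc (n + 1)} (hc : tp c ≤ 0) : tp z ≤ ‖z - c‖ := by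
  have := (le_abs_self _).trans (abs_tp_le_norm (z - c))
  rw [tp_sub] at this
  linarith

lemma integrable_potential_succ {d : ℝ} (ha : AEStronglyMeasurable a μ) (hb : Measurable b)
    (hb0 : ∀ᵐ w ∂μ, tp (b w) ≤ 0) {z : Euc (n + 1)} (hz : z ∈ upperHS n)
    (h : Integrable (fun w => |a w| * ‖z - b w‖ ^ (-d)) μ) :
    Integrable (fun w => |a w| * ‖z - b w‖ ^ (-(d + 1))) μ := by
  have hz' : 0 < tp z := hz
  refine (h.const_mul (tp z)⁻¹).mono' ?_ ?_
  · have hm : Measurable fun w => ‖z - b w‖ ^ (-(d + 1)) := by fun_prop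
    exact (continuous_abs.comp_aestronglyMeasurable ha).mul hm.aestronglyMeasurable
  · filter_upwards [hb0] with w hw
    have h1 := tp_le_norm_sub (z := z) hw
    have h2 : 0 < ‖z - b w‖ := hz'.trans_le h1
    rw [Real.norm_of_nonneg (by positivity), neg_add, rpow_add h2, rpow_neg_one]
    calc |a w| * (‖z - b w‖ ^ (-d) * ‖z - b w‖⁻¹)
        ≤ |a w| * (‖z - b w‖ ^ (-d) * (tp z)⁻¹) := by gcongr
      _ = _ := by ring

lemma integrable_potential {F : Type} [NormedAddCommGroup F] [NormedSpace ℝ F]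
    [FiniteDimensional ℝ F] {d : ℝ} {k : Euc (n + 1) → F} (ha : AEStronglyMeasurable a μ)
    (hb : Measurable b) (hb0 : ∀ᵐ w ∂μ, tp (b w) ≤ 0) (hk : IsHomog d k)
    {z : Euc (n + 1)} (hz : z ∈ upperHS n)
    (h : Integrable (fun w => |a w| * ‖z - b w‖ ^ (-d)) μ) :
    Integrable (fun w => a w • k (z - b w)) μ := by
  obtain ⟨C, hC, hkC⟩ := hk.bound
  have hz' : 0 < tp z := hz
  refine (h.const_mul C).mono' (aestronglyMeasurable_potential ha hb hk z) ?_
  filter_upwards [hb0] with w hw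
  have h2 : 0 < ‖z - b w‖ := hz'.trans_le (tp_le_norm_sub hw)
  rw [norm_smul, Real.norm_eq_abs]
  calc |a w| * ‖k (z - b w)‖ ≤ |a w| * (C * ‖z - b w‖ ^ (-d)) := by
        gcongr; exact hkC _ (norm_pos_iff.1 h2)
    _ = _ := by ring

lemma hasFDerivAt_potential {F : Type} [NormedAddCommGroup F] [NormedSpace ℝ F]
    [FiniteDimensional ℝ F] {d : ℝ} {k : Euc (n + 1) → F} (ha : AEStronglyMeasurable a μ)
    (hb : Measurable b) (hb0 : ∀ᵐ w ∂μ, tp (b w) ≤ 0) (hk : IsHomog d k) (hd : 0 ≤ d)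
    {z : Euc (n + 1)} (hz : z ∈ upperHS n)
    (h1 : Integrable (fun w => a w • k (z - b w)) μ)
    (h2 : Integrable (fun w => |a w| * ‖z - b w‖ ^ (-(d + 1))) μ) :
    HasFDerivAt (fun z => ∫ w, a w • k (z - b w) ∂μ)
      (∫ w, a w • fderiv ℝ k (z - b w) ∂μ) z := by
  obtain ⟨C, hC, hkC⟩ := hk.fderiv.bound
  have hz' : 0 < tp z := hz
  refine hasFDerivAt_integral_of_dominated_of_fderiv_le
    (F := fun z w => a w • k (z - b w)) (F' := fun z w => a w • fderiv ℝ k (z - b w))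
    (bound := fun w => C * 2 ^ (d + 1) * (|a w| * ‖z - b w‖ ^ (-(d + 1))))
    (Metric.ball_mem_nhds z (half_pos hz'))
    (Filter.Eventually.of_forall fun z => aestronglyMeasurable_potential ha hb hk z)
    h1 (aestronglyMeasurable_potential ha hb hk.fderiv z) ?_ (h2.const_mul _) ?_
  · filter_upwards [hb0] with w hw z' hzz'
    have e1 := tp_le_norm_sub (z := z) hw
    have e2 : ‖z - b w‖ ≤ ‖z' - b w‖ + ‖z' - z‖ := by
      have := norm_sub_le (z' - b w) (z' - z)
      simpa using this
    have e3 : ‖z' - z‖ < tp z / 2 := by simpa [dist_eq_norm] using hzz'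
    have e4 : ‖z - b w‖ / 2 ≤ ‖z' - b w‖ := by linarith
    have e5 : 0 < ‖z - b w‖ := by linarith
    have e6 : 0 < ‖z' - b w‖ := by linarith
    rw [norm_smul, Real.norm_eq_abs]
    have e7 : ‖z' - b w‖ ^ (-(d + 1)) ≤ 2 ^ (d + 1) * ‖z - b w‖ ^ (-(d + 1)) := by
      calc ‖z' - b w‖ ^ (-(d + 1)) ≤ (‖z - b w‖ / 2) ^ (-(d + 1)) :=
            rpow_le_rpow_of_nonpos (by positivity) e4 (by linarith)
        _ = _ := by
            rw [div_rpow e5.le (by norm_num), rpow_neg (by norm_num : (0 : ℝ) ≤ 2), div_inv_eq_mul,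
              mul_comm]
    calc |a w| * ‖fderiv ℝ k (z' - b w)‖
        ≤ |a w| * (C * ‖z' - b w‖ ^ (-(d + 1))) := by
          gcongr; exact hkC _ (norm_pos_iff.1 e6)
      _ ≤ |a w| * (C * (2 ^ (d + 1) * ‖z - b w‖ ^ (-(d + 1)))) := by gcongr
      _ = _ := by ring
  · filter_upwards [hb0] with w hw z' hzz'
    have e1 := tp_le_norm_sub (z := z) hw
    have e2 : ‖z - b w‖ ≤ ‖z' - b w‖ + ‖z' - z‖ := by
      have := norm_sub_le (z' - b w) (z' - z)
      simpa using this
    have e3 : ‖z' - z‖ < tp z / 2 := by simpa [dist_eq_norm] using hzz'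
    have e6 : z' - b w ≠ 0 := norm_pos_iff.1 (by linarith)
    have hkd : DifferentiableAt ℝ k (z' - b w) :=
      (hk.smooth.contDiffAt (isOpen_compl_singleton.mem_nhds e6)).differentiableAt (by simp)
    have := hkd.hasFDerivAt.comp z' ((hasFDerivAt_id z').sub_const (b w))
    exact this.const_smul (a w)

lemma contDiffOn_potential (ha : AEStronglyMeasurable a μ)
    (hb : Measurable b) (hb0 : ∀ᵐ w ∂μ, tp (b w) ≤ 0) (j : ℕ) :
    ∀ {F : Type} [NormedAddCommGroup F] [NormedSpace ℝ F] [FiniteDimensional ℝ F] {d : ℝ}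
      {k : Euc (n + 1) → F}, IsHomog d k → 0 ≤ d →
    (∀ z ∈ upperHS n, Integrable (fun w => a w • k (z - b w)) μ) →
    (∀ z ∈ upperHS n, Integrable (fun w => |a w| * ‖z - b w‖ ^ (-(d + 1))) μ) →
    ContDiffOn ℝ j (fun z => ∫ w, a w • k (z - b w) ∂μ) (upperHS n) := by
  induction j with
  | zero =>
    intro F _ _ _ d k hk hd h1 h2
    refine contDiffOn_zero.2 fun z hz => ?_
    exact (hasFDerivAt_potential ha hb hb0 hk hd hz (h1 z hz)
      (h2 z hz)).continuousAt.continuousWithinAt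
  | succ j ih =>
    intro F _ _ _ d k hk hd h1 h2
    have hD : ∀ z ∈ upperHS n, HasFDerivAt (fun z => ∫ w, a w • k (z - b w) ∂μ)
      (∫ w, a w • fderiv ℝ k (z - b w) ∂μ) z := fun z hz =>
        hasFDerivAt_potential ha hb hb0 hk hd hz (h1 z hz) (h2 z hz)
    push_cast
    rw [contDiffOn_succ_iff_fderiv_of_isOpen isOpen_upperHS]
    refine ⟨fun z hz => (hD z hz).differentiableAt.differentiableWithinAt, by simp, ?_⟩
    refine (ih hk.fderiv (by linarith)
      (fun z hz => integrable_potential ha hb hb0 hk.fderiv hz (h2 z hz))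
      (fun z hz => integrable_potential_succ ha hb hb0 hz (h2 z hz))).congr fun z hz => ?_
    exact (hD z hz).fderiv

lemma harmonicOnE_potential (ha : AEStronglyMeasurable a μ)
    (hb : Measurable b) (hb0 : ∀ᵐ w ∂μ, tp (b w) ≤ 0) {d : ℝ}
    {k : Euc (n + 1) → ℝ} (hk : IsHomog d k) (hd : 0 ≤ d) (hkh : HarmonicOnE k {0}ᶜ)
    (h1 : ∀ z ∈ upperHS n, Integrable (fun w => a w * k (z - b w)) μ)
    (h2 : ∀ z ∈ upperHS n, Integrable (fun w => |a w| * ‖z - b w‖ ^ (-(d + 1))) μ) :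
    HarmonicOnE (fun z => ∫ w, a w * k (z - b w) ∂μ) (upperHS n) := by
  refine ⟨contDiffOn_potential ha hb hb0 2 hk hd h1 h2, fun z hz => ?_⟩
  have i1 := fun z (hz : z ∈ upperHS n) =>
    integrable_potential ha hb hb0 hk.fderiv hz (h2 z hz)
  have i2 := fun z (hz : z ∈ upperHS n) =>
    integrable_potential_succ ha hb hb0 hz (h2 z hz)
  have hD : fderiv ℝ (fun z => ∫ w, a w * k (z - b w) ∂μ) =ᶠ[nhds z]
      fun z => ∫ w, a w • fderiv ℝ k (z - b w) ∂μ := by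
    filter_upwards [isOpen_upperHS.mem_nhds hz] with y hy
    exact (hasFDerivAt_potential ha hb hb0 hk hd hy (h1 y hy) (h2 y hy)).fderiv
  have hDD := (hasFDerivAt_potential ha hb hb0 hk.fderiv (by linarith) hz (i1 z hz)
    (i2 z hz)).fderiv
  have i3 := integrable_potential ha hb hb0 hk.fderiv.fderiv hz (i2 z hz)
  have key : ∀ v, d2 (fun z => ∫ w, a w * k (z - b w) ∂μ) z v
      = ∫ w, a w * d2 k (z - b w) v ∂μ := by
    intro v
    rw [d2_eq_fderiv, hD.fderiv_eq, hDD, ContinuousLinearMap.integral_apply i3,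
      ContinuousLinearMap.integral_apply (i3.apply_continuousLinearMap v)]
    simp [d2_eq_fderiv]
  have hint : ∀ v, Integrable (fun w => a w * d2 k (z - b w) v) μ := by
    intro v
    have := (i3.apply_continuousLinearMap v).apply_continuousLinearMap v
    simpa [d2_eq_fderiv] using this
  simp_rw [key]
  rw [← integral_finsetSum _ fun i _ => hint _]
  refine integral_eq_zero_of_ae ?_
  filter_upwards [hb0] with w hw
  have h0 : z - b w ≠ 0 := norm_pos_iff.1 ((show 0 < tp z from hz).trans_le (tp_le_norm_sub hw))
  simp only [← Finset.mul_sum]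
  rw [hkh.2 _ h0]; simp

lemma hasDerivAt_potential (ha : AEStronglyMeasurable a μ)
    (hb : Measurable b) (hb0 : ∀ᵐ w ∂μ, tp (b w) ≤ 0) {j : ℕ} {x : Euc n} {t : ℝ} (ht : 0 < t)
    (h1 : Integrable (fun w => a w * poissonDeriv n j (pt x t - b w)) μ)
    (h2 : Integrable (fun w => |a w| * ‖pt x t - b w‖ ^ (-((n : ℝ) + j + 1))) μ) :
    HasDerivAt (fun u => ∫ w, a w * poissonDeriv n j (pt x u - b w) ∂μ)
      (∫ w, a w * poissonDeriv n (j + 1) (pt x t - b w) ∂μ) t := by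
  have hz : pt x t ∈ upperHS n := pt_mem_upperHS.2 ht
  have hh := isHomog_poissonDeriv n j
  have := (hasFDerivAt_potential ha hb hb0 hh (by positivity) hz h1 h2).comp_hasDerivAt t
    (hasDerivAt_pt x t)
  rw [ContinuousLinearMap.integral_apply (integrable_potential ha hb hb0 hh.fderiv hz h2)] at this
  exact this

end Potential

section Estimates

variable {n : ℕ}

lemma integrable_norm_pt_one {r : ℝ} (hr : (n : ℝ) < r) :
    Integrable (fun v : Euc n => ‖pt v 1‖ ^ (-r)) := by
  have h := integrable_one_add_norm (E := Euc n) (μ := volume) (r := r) (by simpa using hr)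
  refine (h.const_mul (2 ^ r)).mono' ?_ (Filter.Eventually.of_forall fun v => ?_)
  · have hc : Continuous fun v : Euc n => pt v 1 := by fun_prop
    exact (hc.norm.measurable.pow_const _).aestronglyMeasurable
  · have h0 : (0 : ℝ) ≤ n := by positivity
    have h1 := norm_le_norm_pt v 1
    have h2 := abs_tp_le_norm (pt v 1)
    rw [tp_pt, abs_one] at h2
    rw [Real.norm_of_nonneg (by positivity)]
    calc ‖pt v 1‖ ^ (-r) ≤ ((1 + ‖v‖) / 2) ^ (-r) :=
          rpow_le_rpow_of_nonpos (by positivity) (by linarith) (by linarith)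
      _ = _ := by
          rw [div_rpow (by positivity) (by norm_num), rpow_neg (by norm_num : (0 : ℝ) ≤ 2),
            div_inv_eq_mul, mul_comm]

lemma norm_pt_smul_rpow {u : ℝ} (hu : 0 < u) (r : ℝ) (v : Euc n) :
    ‖pt (u • v) u‖ ^ (-r) = u ^ (-r) * ‖pt v 1‖ ^ (-r) := by
  have : pt (u • v) u = u • pt v 1 := by rw [smul_pt, mul_one]
  rw [this, norm_smul, Real.norm_of_nonneg hu.le, mul_rpow hu.le (norm_nonneg _)]

lemma integrable_norm_pt {r u : ℝ} (hr : (n : ℝ) < r) (hu : 0 < u) (x : Euc n) :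
    Integrable (fun y : Euc n => ‖pt (x - y) u‖ ^ (-r)) := by
  have h : Integrable (fun y : Euc n => ‖pt y u‖ ^ (-r)) := by
    rw [← integrable_comp_smul_iff volume _ hu.ne']
    simp_rw [norm_pt_smul_rpow hu]
    exact (integrable_norm_pt_one hr).const_mul _
  exact h.comp_sub_left x

lemma integral_norm_pt {r u : ℝ} (hu : 0 < u) (x : Euc n) :
    ∫ y : Euc n, ‖pt (x - y) u‖ ^ (-r) = u ^ (n - r) * ∫ v : Euc n, ‖pt v 1‖ ^ (-r) := by
  rw [integral_sub_left_eq_self (fun y : Euc n => ‖pt y u‖ ^ (-r)) volume x]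
  have h := Measure.integral_comp_smul volume (fun y : Euc n => ‖pt y u‖ ^ (-r)) u
  simp_rw [norm_pt_smul_rpow hu] at h
  rw [integral_const_mul] at h
  simp only [finrank_euclideanSpace, Fintype.card_fin, smul_eq_mul] at h
  rw [abs_of_pos (by positivity)] at h
  rw [sub_eq_add_neg, rpow_add hu, mul_assoc, h, rpow_natCast, ← mul_assoc,
    mul_inv_cancel₀ (by positivity), one_mul]

lemma integrableOn_rpow_mul_one_add {γ e : ℝ} (hγ : -1 < γ) (he : γ + 1 < e) :
    IntegrableOn (fun s : ℝ => s ^ γ * (1 + s) ^ (-e)) (Ioi 0) := by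
  have hm : Measurable fun s : ℝ => s ^ γ * (1 + s) ^ (-e) := by fun_prop
  rw [← Ioc_union_Ioi_eq_Ioi zero_le_one]
  refine IntegrableOn.union ?_ ?_
  · have h : IntegrableOn (fun s : ℝ => s ^ γ) (Ioc 0 1) := by
      rw [← intervalIntegrable_iff_integrableOn_Ioc_of_le zero_le_one]
      exact intervalIntegral.intervalIntegrable_rpow' hγ
    refine h.mono' hm.aestronglyMeasurable ?_
    filter_upwards [ae_restrict_mem measurableSet_Ioc] with s hs
    have hs0 := hs.1
    rw [Real.norm_of_nonneg (by positivity)]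
    refine mul_le_of_le_one_right (by positivity) ?_
    exact rpow_le_one_of_one_le_of_nonpos (by linarith) (by linarith)
  · have h := integrableOn_Ioi_rpow_of_lt (a := γ - e) (by linarith) one_pos
    refine h.mono' hm.aestronglyMeasurable ?_
    filter_upwards [ae_restrict_mem measurableSet_Ioi] with s hs
    have hs0 : 0 < s := one_pos.trans hs
    rw [Real.norm_of_nonneg (by positivity), sub_eq_add_neg, rpow_add hs0]
    gcongr ?_ * ?_
    exact rpow_le_rpow_of_nonpos hs0 (by linarith) (by linarith)

lemma rpow_mul_add_rpow_scale {γ e t s : ℝ} (ht : 0 < t) (hs : 0 < s) :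
    (t * s) ^ γ * (t + t * s) ^ (-e) = t ^ (γ - e) * (s ^ γ * (1 + s) ^ (-e)) := by
  have : t + t * s = t * (1 + s) := by ring
  rw [this, mul_rpow ht.le hs.le, mul_rpow ht.le (by positivity), sub_eq_add_neg, rpow_add ht]
  ring

lemma integrableOn_rpow_mul_add {γ e t : ℝ} (hγ : -1 < γ) (he : γ + 1 < e) (ht : 0 < t) :
    IntegrableOn (fun s : ℝ => s ^ γ * (t + s) ^ (-e)) (Ioi 0) := by
  have h := integrableOn_Ioi_comp_mul_left_iff (fun s : ℝ => s ^ γ * (t + s) ^ (-e)) 0 ht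
  rw [mul_zero] at h
  rw [← h]
  have h1 : IntegrableOn (fun s : ℝ => t ^ (γ - e) * (s ^ γ * (1 + s) ^ (-e))) (Ioi 0) :=
    (integrableOn_rpow_mul_one_add hγ he).const_mul (t ^ (γ - e))
  refine h1.congr_fun ?_ measurableSet_Ioi
  intro s hs
  exact (rpow_mul_add_rpow_scale ht hs).symm

lemma integral_rpow_mul_add {γ e t : ℝ} (ht : 0 < t) :
    ∫ s in Ioi (0 : ℝ), s ^ γ * (t + s) ^ (-e)
      = t ^ (γ + 1 - e) * ∫ s in Ioi (0 : ℝ), s ^ γ * (1 + s) ^ (-e) := by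
  have h := integral_comp_mul_left_Ioi (fun s : ℝ => s ^ γ * (t + s) ^ (-e)) 0 ht
  rw [mul_zero, setIntegral_congr_fun (g := fun s => t ^ (γ - e) * (s ^ γ * (1 + s) ^ (-e)))
    measurableSet_Ioi (fun s hs => rpow_mul_add_rpow_scale ht hs), integral_const_mul] at h
  have h2 : t ^ (γ + 1 - e) = t * t ^ (γ - e) := by
    rw [add_sub_right_comm, rpow_add_one ht.ne', mul_comm]
  rw [h2, mul_assoc, h, smul_eq_mul, ← mul_assoc, mul_inv_cancel₀ ht.ne', one_mul]

/-- Lebesgue measure on the half space `ℝⁿ × (0, ∞)` -/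
abbrev halfVol (n : ℕ) : Measure (Euc n × ℝ) :=
  (volume : Measure (Euc n)).prod ((volume : Measure ℝ).restrict (Ioi 0))

lemma halfVol_eq (n : ℕ) : halfVol n =
    ((volume : Measure (Euc n)).prod (volume : Measure ℝ)).restrict (univ ×ˢ Ioi 0) := by
  rw [← Measure.prod_restrict, Measure.restrict_univ]

lemma ae_halfVol_pos (n : ℕ) : ∀ᵐ w ∂(halfVol n), 0 < w.2 := by
  rw [halfVol_eq]
  filter_upwards [ae_restrict_mem (MeasurableSet.univ.prod measurableSet_Ioi)] with w hw
  exact hw.2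

lemma measurable_kernel_weight (γ r : ℝ) (x : Euc n) (t : ℝ) :
    Measurable (fun w : Euc n × ℝ => w.2 ^ γ * ‖pt x t - pt w.1 (-w.2)‖ ^ (-r)) := by
  have hc : Continuous fun w : Euc n × ℝ => pt w.1 (-w.2) := by fun_prop
  exact (measurable_snd.pow_const _).mul (((hc.measurable.const_sub _).norm).pow_const _)

lemma integrable_kernel_weight {γ r t : ℝ} (hγ : -1 < γ) (hr : (n : ℝ) + γ + 1 < r) (ht : 0 < t)
    (x : Euc n) :
    Integrable (fun w : Euc n × ℝ => w.2 ^ γ * ‖pt x t - pt w.1 (-w.2)‖ ^ (-r)) (halfVol n) := by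
  rw [integrable_prod_iff' (measurable_kernel_weight γ r x t).aestronglyMeasurable]
  simp only [pt_sub, sub_neg_eq_add]
  constructor
  · filter_upwards [ae_restrict_mem measurableSet_Ioi] with s hs
    have hs' : 0 < s := hs
    exact (integrable_norm_pt (by linarith) (by positivity) x).const_mul _
  · refine ((integrableOn_rpow_mul_add hγ (e := r - n) (by linarith) ht).mul_const
      (∫ v : Euc n, ‖pt v 1‖ ^ (-r))).congr ?_
    filter_upwards [ae_restrict_mem measurableSet_Ioi] with s hs
    have hs' : 0 < s := hs
    have : ∀ y, ‖s ^ γ * ‖pt (x - y) (t + s)‖ ^ (-r)‖ = s ^ γ * ‖pt (x - y) (t + s)‖ ^ (-r) :=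
      fun y => Real.norm_of_nonneg (by positivity)
    simp_rw [this]
    rw [integral_const_mul, integral_norm_pt (by positivity), neg_sub, mul_assoc]

lemma integral_kernel_weight {γ r t : ℝ} (hγ : -1 < γ) (hr : (n : ℝ) + γ + 1 < r) (ht : 0 < t)
    (x : Euc n) :
    ∫ w : Euc n × ℝ, w.2 ^ γ * ‖pt x t - pt w.1 (-w.2)‖ ^ (-r) ∂(halfVol n)
      = t ^ (n + γ + 1 - r) * ((∫ s in Ioi (0 : ℝ), s ^ γ * (1 + s) ^ (-(r - n)))
        * ∫ v : Euc n, ‖pt v 1‖ ^ (-r)) := by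
  rw [integral_prod_symm _ (integrable_kernel_weight hγ hr ht x)]
  simp only [pt_sub, sub_neg_eq_add]
  rw [setIntegral_congr_fun (g := fun s => (s ^ γ * (t + s) ^ (-(r - n)))
    * ∫ v : Euc n, ‖pt v 1‖ ^ (-r)) measurableSet_Ioi, integral_mul_const,
    integral_rpow_mul_add ht, mul_assoc]
  · congr 2; ring
  · intro s hs
    have hs' : 0 < s := hs
    simp only
    rw [integral_const_mul, integral_norm_pt (by positivity), neg_sub, mul_assoc]

lemma lintegral_one_add_lt_top {α A : ℝ} (hα : -1 < α) (hA : (n : ℝ) + 1 + α < A) :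
    ∫⁻ z : Euc n × ℝ, ENNReal.ofReal ((1 + ‖z.1‖ + z.2) ^ (-A)) * ENNReal.ofReal (z.2 ^ α)
      ∂(halfVol n) < ⊤ := by
  set δ := (A - n - 1 - α) / 2 with hδ
  have hδ0 : 0 < δ := by rw [hδ]; linarith
  have h1 : Integrable (fun x : Euc n => (1 + ‖x‖) ^ (-(n + δ))) :=
    integrable_one_add_norm (by simpa using hδ0)
  have h2 : IntegrableOn (fun s : ℝ => s ^ α * (1 + s) ^ (-(α + 1 + δ))) (Ioi 0) :=
    integrableOn_rpow_mul_one_add hα (by linarith)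
  have h3 := (h1.mul_prod h2).lintegral_lt_top
  refine lt_of_le_of_lt (lintegral_mono_ae ?_) h3
  filter_upwards [ae_halfVol_pos n] with z hz
  have h0 : (0 : ℝ) ≤ n := by positivity
  have hx := norm_nonneg z.1
  rw [← ENNReal.ofReal_mul (by positivity)]
  refine ENNReal.ofReal_le_ofReal ?_
  have : -A = -(n + δ) + -(α + 1 + δ) := by rw [hδ]; ring
  rw [this, rpow_add (by positivity)]
  have e1 : (1 + ‖z.1‖ + z.2) ^ (-(n + δ)) ≤ (1 + ‖z.1‖) ^ (-(n + δ)) :=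
    rpow_le_rpow_of_nonpos (by positivity) (by linarith) (by linarith)
  have e2 : (1 + ‖z.1‖ + z.2) ^ (-(α + 1 + δ)) ≤ (1 + z.2) ^ (-(α + 1 + δ)) :=
    rpow_le_rpow_of_nonpos (by positivity) (by linarith) (by linarith)
  calc _ ≤ (1 + ‖z.1‖) ^ (-(n + δ)) * (1 + z.2) ^ (-(α + 1 + δ)) * z.2 ^ α := by gcongr
    _ = _ := by ring

end Estimates

section MaximumPrinciple

lemma IsLocalMax.d2_nonpos {V : Type*} [NormedAddCommGroup V] [NormedSpace ℝ V] {f : V → ℝ}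
    {z : V} (hf : ContDiffAt ℝ 2 f z) (h : IsLocalMax f z) (v : V) : d2 f z v ≤ 0 := by
  have hl : ∀ t : ℝ, HasDerivAt (fun t : ℝ => z + t • v) v t := fun t => by
    simpa using ((hasDerivAt_id t).smul_const v).const_add z
  have hlc : Filter.Tendsto (fun t : ℝ => z + t • v) (nhds 0) (nhds z) := by
    have := (hl 0).continuousAt.tendsto
    simpa using this
  have h1 : deriv (fun t : ℝ => f (z + t • v)) =ᶠ[nhds 0] fun t => fderiv ℝ f (z + t • v) v := by
    filter_upwards [hlc.eventually (hf.eventually (by simp))] with t ht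
    exact ((ht.differentiableAt (by norm_num)).hasFDerivAt.comp_hasDerivAt t (hl t)).deriv
  have h2 : deriv (deriv (fun t : ℝ => f (z + t • v))) 0 = d2 f z v := by
    rw [h1.deriv_eq, d2_eq_fderiv]
    have hd := differentiableAt_fderiv_of_contDiffAt hf
    have hd' : HasFDerivAt (fderiv ℝ f) (fderiv ℝ (fderiv ℝ f) z) (z + (0 : ℝ) • v) := by
      simpa using hd.hasFDerivAt
    have h3 := hd'.comp_hasDerivAt (0 : ℝ) (hl 0)
    have h4 := h3.clm_apply (hasDerivAt_const (0 : ℝ) v)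
    simpa using h4.deriv
  have hmax : IsLocalMax (fun t : ℝ => f (z + t • v)) 0 := by
    have := hlc.eventually h
    filter_upwards [this] with t ht
    simpa using ht
  by_contra hpos
  push Not at hpos
  rw [← h2] at hpos
  have hc : ContinuousAt (fun t : ℝ => f (z + t • v)) 0 := by
    have : ContinuousAt f (z + (0 : ℝ) • v) := by simpa using hf.continuousAt
    exact ContinuousAt.comp (f := fun t : ℝ => z + t • v) this (hl 0).continuousAt
  have hmin := isLocalMin_of_deriv_deriv_pos hpos hmax.deriv_eq_zero hc
  have hconst : (fun t : ℝ => f (z + t • v)) =ᶠ[nhds 0] fun _ => f (z + (0 : ℝ) • v) := by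
    filter_upwards [hmax, hmin] with t a b using le_antisymm a b
  rw [hconst.deriv.deriv_eq] at hpos
  simp at hpos

variable {n : ℕ}

/-- a quadratic barrier with Laplacian `-2 ε` -/
lemma barrier_spec (c ε C : ℝ) :
    ContDiff ℝ 2 (fun z : Euc (n + 1) => c * tp z + ε * (‖z‖ ^ 2 - (n + 2) * tp z ^ 2 + C)) ∧
    ∀ z : Euc (n + 1), ∑ i, d2 (fun z : Euc (n + 1) =>
      c * tp z + ε * (‖z‖ ^ 2 - (n + 2) * tp z ^ 2 + C)) z (EuclideanSpace.single i 1)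
        = -2 * ε := by
  have hcd : ContDiff ℝ 2
      (fun z : Euc (n + 1) => c * tp z + ε * (‖z‖ ^ 2 - (n + 2) * tp z ^ 2 + C)) :=
    (contDiff_const.mul contDiff_tp).add (contDiff_const.mul
      (((contDiff_norm_sq ℝ).sub (contDiff_const.mul (contDiff_tp.pow 2))).add contDiff_const))
  refine ⟨hcd, fun z => ?_⟩
  set g := fun z : Euc (n + 1) => c * tp z + ε * (‖z‖ ^ 2 - (n + 2) * tp z ^ 2 + C) with hg
  have htp : ∀ z : Euc (n + 1), HasFDerivAt tp
      (EuclideanSpace.proj (𝕜 := ℝ) (Fin.last n) : Euc (n + 1) →L[ℝ] ℝ) z := fun z =>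
    (EuclideanSpace.proj (𝕜 := ℝ) (Fin.last n) : Euc (n + 1) →L[ℝ] ℝ).hasFDerivAt
  have h1 : ∀ w v, fderiv ℝ g w v
      = c * tp v + ε * (2 * innerSL ℝ v w - (n + 2) * (2 * (tp w * tp v))) := by
    intro w v
    have h := (((htp w).const_mul c).add
      ((((hasStrictFDerivAt_norm_sq w).hasFDerivAt.sub
        (((htp w).pow 2).const_mul ((n : ℝ) + 2))).add_const C).const_mul ε)).fderiv
    have e : fderiv ℝ g w v = _ := congrArg (fun L => L v) h
    rw [e]
    simp [real_inner_comm]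
    simp [tp]
    exact Or.inl (Or.inl (by ring))
  have h2 : ∀ v, d2 g z v = ε * (2 * innerSL ℝ v v - (n + 2) * (2 * (tp v * tp v))) := by
    intro v
    have hd := differentiableAt_fderiv_of_contDiffAt (hcd.contDiffAt (x := z))
    have e0 : d2 g z v = fderiv ℝ (fun w => fderiv ℝ g w v) z v := by
      rw [d2_eq_fderiv, fderiv_clm_apply hd (by fun_prop)]; simp
    have e1 : (fun w => fderiv ℝ g w v) = fun w => c * tp v +
        ε * (2 * innerSL ℝ v w - (n + 2) * (2 * (tp w * tp v))) := funext fun w => h1 w v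
    have hi : HasFDerivAt (fun w => innerSL ℝ v w) (innerSL ℝ v) z := (innerSL ℝ v).hasFDerivAt
    have h3 := ((((hi.const_mul 2).sub ((((htp z).mul_const (tp v)).const_mul 2).const_mul
      ((n : ℝ) + 2))).const_mul ε).const_add (c * tp v)).fderiv
    rw [e0, e1]
    have e : fderiv ℝ (fun w => c * tp v +
        ε * (2 * innerSL ℝ v w - (n + 2) * (2 * (tp w * tp v)))) z v = _ :=
      congrArg (fun L => L v) h3
    rw [e]
    simp
    simp [tp]
  simp_rw [h2]
  rw [← Finset.mul_sum, Finset.sum_sub_distrib, ← Finset.mul_sum, ← Finset.mul_sum,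
    ← Finset.mul_sum]
  have s1 : ∑ i, tp (EuclideanSpace.single i (1 : ℝ) : Euc (n + 1)) *
      tp (EuclideanSpace.single i (1 : ℝ) : Euc (n + 1)) = 1 := by
    simp [tp]
  rw [s1]
  simp
  ring

lemma le_barrier {U : Euc (n + 1) → ℝ} (hc : ContinuousOn U {z | 0 ≤ tp z})
    (hU : HarmonicOnE U (upperHS n)) {M : ℝ} (hM0 : 0 ≤ M) (hM : ∀ z, 0 ≤ tp z → U z ≤ M)
    (h0 : ∀ z, tp z = 0 → U z ≤ 0) {z : Euc (n + 1)} (hz : 0 < tp z) {L ε : ℝ} (hL : tp z < L)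
    (hε : 0 < ε) :
    U z ≤ M / L * tp z + ε * (‖z‖ ^ 2 - (n + 2) * tp z ^ 2 + (n + 1) * L ^ 2) := by
  have hL0 : 0 < L := hz.trans hL
  obtain ⟨hgc, hgl⟩ := barrier_spec (n := n) (M / L) ε ((n + 1) * L ^ 2)
  set g := fun z : Euc (n + 1) =>
    M / L * tp z + ε * (‖z‖ ^ 2 - (n + 2) * tp z ^ 2 + (n + 1) * L ^ 2) with hg
  set a := M / ε + ‖z‖ + 1 with ha
  have hMε : 0 ≤ M / ε := by positivity
  have hzn := norm_nonneg z
  set K : Set (Euc (n + 1)) := Metric.closedBall 0 (L + a) ∩ {w | 0 ≤ tp w ∧ tp w ≤ L} with hK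
  have hKc : IsCompact K := (isCompact_closedBall _ _).inter_right
    ((isClosed_le continuous_const continuous_tp).inter
      (isClosed_le continuous_tp continuous_const))
  have hzK : z ∈ K := ⟨by rw [mem_closedBall_zero_iff]; linarith, hz.le, hL.le⟩
  have hvc : ContinuousOn (fun w => 1 * U w + (-1) * g w) K :=
    (continuousOn_const.mul (hc.mono fun w hw => hw.2.1)).add
      (continuousOn_const.mul hgc.continuous.continuousOn)
  obtain ⟨w, hwK, hw⟩ := hKc.exists_isMaxOn ⟨z, hzK⟩ hvc
  have hwz : 1 * U z + (-1) * g z ≤ 1 * U w + (-1) * g w := hw hzK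
  have hw0 : 0 ≤ tp w := hwK.2.1
  have hwL : tp w ≤ L := hwK.2.2
  have hwn : ‖w‖ ≤ L + a := by simpa using hwK.1
  have htw := abs_tp_le_norm w
  rw [abs_of_nonneg hw0] at htw
  have hML : 0 ≤ M / L * tp w := by positivity
  suffices hs : U w ≤ g w by linarith
  by_contra hcon
  push Not at hcon
  have hw0' : 0 < tp w := by
    refine lt_of_le_of_ne hw0 fun h => ?_
    have := h0 w h.symm
    have hgw : 0 ≤ g w := by
      simp only [hg, ← h]
      have : (0 : ℝ) ≤ n := by positivity
      have : 0 ≤ ‖w‖ ^ 2 - (n + 2) * (0 : ℝ) ^ 2 + (n + 1) * L ^ 2 := by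
        have : 0 ≤ ‖w‖ ^ 2 + (n + 1) * L ^ 2 := by positivity
        linarith
      have := mul_nonneg hε.le this
      linarith
    linarith
  have hwL' : tp w < L := by
    refine lt_of_le_of_ne hwL fun h => ?_
    have h1 := hM w hw0
    have hgw : M ≤ g w := by
      simp only [hg]
      rw [h, div_mul_cancel₀ _ hL0.ne']
      have : 0 ≤ ε * (‖w‖ ^ 2 - (n + 2) * L ^ 2 + (n + 1) * L ^ 2) := by
        refine mul_nonneg hε.le ?_
        rw [h] at htw
        nlinarith
      linarith
    linarith
  have hwn' : ‖w‖ < L + a := by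
    refine lt_of_le_of_ne hwn fun h => ?_
    have h1 := hM w hw0
    have hgw : M ≤ g w := by
      simp only [hg]
      have h2 : M / ε ≤ ‖w‖ ^ 2 - (n + 2) * tp w ^ 2 + (n + 1) * L ^ 2 := by
        have h3 : tp w ^ 2 ≤ L ^ 2 := by gcongr
        have h4 : ((n : ℝ) + 2) * tp w ^ 2 ≤ (n + 2) * L ^ 2 := by gcongr
        have h5 : M / ε ≤ a := by linarith
        have h6 : a ≤ a ^ 2 := by nlinarith
        have h7 : 0 ≤ L * a := by have : 0 ≤ a := by linarith
                                  positivity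
        rw [h]
        nlinarith
      have h3 : M ≤ ε * (‖w‖ ^ 2 - (n + 2) * tp w ^ 2 + (n + 1) * L ^ 2) := by
        rw [div_le_iff₀ hε] at h2
        linarith
      linarith
    linarith
  have hKn : K ∈ nhds w := by
    refine Filter.inter_mem (Metric.closedBall_mem_nhds_of_mem (by simpa using hwn')) ?_
    filter_upwards [(isOpen_lt continuous_const continuous_tp).mem_nhds hw0',
      (isOpen_lt continuous_tp continuous_const).mem_nhds hwL'] with y hy1 hy2
    exact ⟨le_of_lt hy1, le_of_lt hy2⟩
  have hwU : w ∈ upperHS n := hw0'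
  have hUc := hU.1.contDiffAt (isOpen_upperHS.mem_nhds hwU)
  have hlm : IsLocalMax (fun w => 1 * U w + (-1) * g w) w := hw.isLocalMax hKn
  have hvcd : ContDiffAt ℝ 2 (fun w => 1 * U w + (-1) * g w) w :=
    (contDiffAt_const.mul hUc).add (contDiffAt_const.mul hgc.contDiffAt)
  have hle : ∑ i, d2 (fun w => 1 * U w + (-1) * g w) w (EuclideanSpace.single i 1) ≤ 0 :=
    Finset.sum_nonpos fun i _ => hlm.d2_nonpos hvcd _
  simp_rw [d2_linear_comb hUc hgc.contDiffAt, Finset.sum_add_distrib, ← Finset.mul_sum] at hle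
  rw [hU.2 w hwU, hgl w] at hle
  linarith

lemma nonpos_of_boundary_nonpos {U : Euc (n + 1) → ℝ} (hc : ContinuousOn U {z | 0 ≤ tp z})
    (hU : HarmonicOnE U (upperHS n)) {M : ℝ} (hM0 : 0 ≤ M) (hM : ∀ z, 0 ≤ tp z → U z ≤ M)
    (h0 : ∀ z, tp z = 0 → U z ≤ 0) {z : Euc (n + 1)} (hz : 0 < tp z) : U z ≤ 0 := by
  by_contra hη
  push Not at hη
  set L := tp z + 3 * (M * tp z) / U z + 1 with hL
  have hp : 0 ≤ 3 * (M * tp z) / U z := by positivity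
  have hL0 : 0 < L := by linarith
  set B := ‖z‖ ^ 2 - (n + 2) * tp z ^ 2 + (n + 1) * L ^ 2 with hB
  have h := le_barrier hc hU hM0 hM h0 hz (L := L) (ε := U z / (3 * (|B| + 1))) (by linarith)
    (by positivity)
  have h1 : M / L * tp z ≤ U z / 3 := by
    rw [div_mul_eq_mul_div, div_le_div_iff₀ hL0 (by norm_num)]
    have : 3 * (M * tp z) = 3 * (M * tp z) / U z * U z := by field_simp
    nlinarith
  have h2 : U z / (3 * (|B| + 1)) * B ≤ U z / 3 := by
    rw [div_mul_eq_mul_div, div_le_div_iff₀ (by positivity) (by norm_num)]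
    have := le_abs_self B
    nlinarith
  linarith

end MaximumPrinciple

section PoissonSemigroup

variable {n : ℕ}

lemma poissonFun_eq (z : Euc (n + 1)) :
    poissonFun n z = cP n * (tp z * ‖z‖ ^ (-((n : ℝ) + 1))) := by
  rw [poissonFun, ← rpow_natCast ‖z‖ 2, ← rpow_mul (norm_nonneg z), mul_assoc]
  congr 3
  push_cast
  ring

/-- the total mass of the Poisson kernel at height one -/
def poissonMass (n : ℕ) : ℝ := ∫ v : Euc n, poissonFun n (pt v 1)

lemma integrable_poissonFun {u : ℝ} (hu : 0 < u) (x : Euc n) :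
    Integrable (fun y : Euc n => poissonFun n (pt (x - y) u)) := by
  simp_rw [poissonFun_eq, tp_pt]
  exact ((integrable_norm_pt (by linarith) hu x).const_mul u).const_mul (cP n)

lemma integrable_poissonFun_one : Integrable (fun v : Euc n => poissonFun n (pt v 1)) := by
  simp_rw [poissonFun_eq, tp_pt]
  exact ((integrable_norm_pt_one (by linarith)).const_mul 1).const_mul (cP n)

lemma poissonFun_pos {z : Euc (n + 1)} (hz : 0 < tp z) : 0 < poissonFun n z := by
  have := norm_pos_iff.2 (ne_zero_of_tp_pos hz)
  have := cP_pos n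
  rw [poissonFun_eq]
  positivity

lemma poissonMass_pos (n : ℕ) : 0 < poissonMass n := by
  have hs : Function.support (fun v : Euc n => poissonFun n (pt v 1)) = univ :=
    eq_univ_of_forall fun v => (poissonFun_pos (by simp)).ne'
  rw [poissonMass, integral_pos_iff_support_of_nonneg (fun v => (poissonFun_pos (by simp)).le)
    integrable_poissonFun_one, hs]
  exact Measure.measure_univ_pos.2 (NeZero.ne _)

lemma continuousOn_slice {f : Euc (n + 1) → ℝ} (hf : HarmonicOnE f (upperHS n)) {s : ℝ}
    (hs : 0 < s) : Continuous (fun y : Euc n => f (pt y s)) :=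
  hf.1.continuousOn.comp_continuous (by fun_prop) fun y => pt_mem_upperHS.2 hs

lemma integral_dilate_eq (g : Euc n → ℝ) {z : Euc (n + 1)} (hz : 0 < tp z) :
    ∫ v : Euc n, poissonFun n (pt v 1) * g (xp z - tp z • v)
      = ∫ y : Euc n, g y * poissonFun n (z - pt y 0) := by
  set t := tp z with ht
  set ψ : Euc n → ℝ := fun y => g (xp z - y) * poissonFun n (pt y t) with hψ
  have h1 : ∫ y : Euc n, g y * poissonFun n (z - pt y 0) = ∫ y, ψ y := by
    rw [← integral_sub_left_eq_self ψ volume (xp z)]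
    refine integral_congr_ae (Filter.Eventually.of_forall fun y => ?_)
    have : z - pt y 0 = pt (xp z - y) t := by
      conv_lhs => rw [← pt_xp_tp z]
      rw [pt_sub, sub_zero]
    simp only [hψ, this, sub_sub_cancel]
  have h2 := Measure.integral_comp_smul volume ψ t
  have h3 : ∀ v, ψ (t • v) = t ^ (-(n : ℝ)) * (poissonFun n (pt v 1) * g (xp z - t • v)) := by
    intro v
    have : pt (t • v) t = t • pt v 1 := by rw [smul_pt, mul_one]
    simp only [hψ]
    rw [this, (isHomog_poissonFun n).homog t hz, smul_eq_mul]
    ring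
  simp_rw [h3] at h2
  rw [integral_const_mul] at h2
  simp only [finrank_euclideanSpace, Fintype.card_fin, smul_eq_mul] at h2
  rw [abs_of_pos (by positivity), rpow_neg hz.le, rpow_natCast] at h2
  rw [h1]
  exact mul_left_cancel₀ (by positivity) h2

lemma integrable_mul_poissonFun {g : Euc n → ℝ} (hg : Continuous g) {M : ℝ}
    (hM : ∀ y, |g y| ≤ M) {z : Euc (n + 1)} (hz : 0 < tp z) :
    Integrable (fun y : Euc n => g y * poissonFun n (z - pt y 0)) := by
  have h := (integrable_poissonFun hz (xp z)).bdd_mul (f := g) (c := M)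
    hg.aestronglyMeasurable (Filter.Eventually.of_forall fun y => by simpa using hM y)
  refine h.congr (Filter.Eventually.of_forall fun y => ?_)
  have : z - pt y 0 = pt (xp z - y) (tp z) := by
    conv_lhs => rw [← pt_xp_tp z]
    rw [pt_sub, sub_zero]
  simp only [this]

lemma integrable_mul_norm_rpow {g : Euc n → ℝ} (hg : Continuous g) {M : ℝ}
    (hM : ∀ y, |g y| ≤ M) {r : ℝ} (hr : (n : ℝ) < r) {z : Euc (n + 1)} (hz : 0 < tp z) :
    Integrable (fun y : Euc n => |g y| * ‖z - pt y 0‖ ^ (-r)) := by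
  have h := (integrable_norm_pt hr hz (xp z)).bdd_mul (f := fun y => |g y|) (c := M)
    hg.abs.aestronglyMeasurable (Filter.Eventually.of_forall fun y => by simpa using hM y)
  refine h.congr (Filter.Eventually.of_forall fun y => ?_)
  have : z - pt y 0 = pt (xp z - y) (tp z) := by
    conv_lhs => rw [← pt_xp_tp z]
    rw [pt_sub, sub_zero]
  simp only [this]

lemma poisson_semigroup {f : Euc (n + 1) → ℝ} (hf : HarmonicOnE f (upperHS n)) {s M : ℝ}
    (hs : 0 < s) (hM : ∀ z, s ≤ tp z → |f z| ≤ M) {z : Euc (n + 1)} (hz : 0 < tp z) :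
    ∫ y : Euc n, f (pt y s) * poissonFun n (z - pt y 0) = poissonMass n * f (z + pt 0 s) := by
  set g : Euc n → ℝ := fun y => f (pt y s) with hg
  have hgc : Continuous g := continuousOn_slice hf hs
  have hgM : ∀ y, |g y| ≤ M := fun y => hM _ (by simp)
  have hM0 : 0 ≤ M := (abs_nonneg _).trans (hgM 0)
  set κ := poissonMass n with hκ
  have hκ0 : 0 < κ := poissonMass_pos n
  set G : Euc (n + 1) → ℝ := fun z => ∫ v : Euc n, poissonFun n (pt v 1) * g (xp z - tp z • v)
    with hG
  have hb : ∀ (z : Euc (n + 1)) (v : Euc n),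
      ‖poissonFun n (pt v 1) * g (xp z - tp z • v)‖ ≤ poissonFun n (pt v 1) * M := by
    intro z v
    have hp := (poissonFun_pos (n := n) (z := pt v 1) (by simp)).le
    rw [norm_mul, Real.norm_of_nonneg hp]
    exact mul_le_mul_of_nonneg_left (hgM _) hp
  have hGc : Continuous G := by
    refine continuous_of_dominated (bound := fun v => poissonFun n (pt v 1) * M) (fun z => ?_)
      (fun z => Filter.Eventually.of_forall fun v => hb z v)
      (integrable_poissonFun_one.mul_const M) (Filter.Eventually.of_forall fun v => ?_)
    · exact integrable_poissonFun_one.aestronglyMeasurable.mul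
        (hgc.comp (by fun_prop)).aestronglyMeasurable
    · exact continuous_const.mul (hgc.comp (by fun_prop))
  have hGb : ∀ z, |G z| ≤ κ * M := by
    intro z
    rw [← Real.norm_eq_abs, hκ, poissonMass, ← integral_mul_const]
    exact norm_integral_le_of_norm_le (integrable_poissonFun_one.mul_const M)
      (Filter.Eventually.of_forall fun v => hb z v)
  have hGp : ∀ z ∈ upperHS n, G z = ∫ y : Euc n, g y * poissonFun n (z - pt y 0) :=
    fun z hz => integral_dilate_eq g hz
  have hGh : HarmonicOnE G (upperHS n) := by
    refine HarmonicOnE.congr isOpen_upperHS (harmonicOnE_potential (d := n)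
      hgc.aestronglyMeasurable (b := fun y : Euc n => pt y 0) (by fun_prop)
      (Filter.Eventually.of_forall fun y => by simp) (isHomog_poissonFun n) (by positivity)
      (harmonic_poissonFun n) (fun z hz => integrable_mul_poissonFun hgc hgM hz)
      (fun z hz => integrable_mul_norm_rpow hgc hgM (by linarith) hz)) fun z hz => ?_
    exact hGp z hz
  set T : Euc (n + 1) → ℝ := fun z => f (z + pt 0 s) with hT
  have hTh0 := hf.comp_add_right (pt 0 s)
  have htT : ∀ z : Euc (n + 1), tp (z + pt 0 s) = tp z + s := fun z => by rw [tp_add, tp_pt]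
  have hTh : HarmonicOnE T (upperHS n) := hTh0.mono fun z hz => by
    have h : 0 < tp z := hz
    change 0 < tp (z + pt 0 s)
    rw [htT]; linarith
  have hTc : ContinuousOn T {z | 0 ≤ tp z} := by
    refine hTh0.1.continuousOn.mono fun z hz => ?_
    have h : 0 ≤ tp z := hz
    change 0 < tp (z + pt 0 s)
    rw [htT]; linarith
  have hTb : ∀ z, 0 ≤ tp z → |T z| ≤ M := fun z hz => hM _ (by rw [htT]; linarith)
  have hbd : ∀ z, tp z = 0 → G z = κ * T z := by
    intro z hz
    have h1 : z + pt 0 s = pt (xp z) s := by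
      conv_lhs => rw [← pt_xp_tp z]
      rw [hz, pt_add, add_zero, zero_add]
    simp only [hG, hT, hz, h1, zero_smul, sub_zero]
    rw [integral_mul_const, hκ, poissonMass]
  have key : ∀ σ : ℝ, |σ| = 1 → σ * G z + (-σ * κ) * T z ≤ 0 := by
    intro σ hσ
    refine nonpos_of_boundary_nonpos (U := fun z => σ * G z + (-σ * κ) * T z)
      (M := κ * M + κ * M) ?_ ?_ (by positivity) ?_ ?_ hz
    · exact (continuousOn_const.mul hGc.continuousOn).add (continuousOn_const.mul hTc)
    · exact hGh.linear_comb isOpen_upperHS hTh _ _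
    · intro w hw
      have h1 : σ * G w ≤ κ * M := by
        refine (le_abs_self _).trans ?_
        rw [abs_mul, hσ, one_mul]; exact hGb w
      have h2 : (-σ * κ) * T w ≤ κ * M := by
        refine (le_abs_self _).trans ?_
        rw [abs_mul, abs_mul, abs_neg, hσ, one_mul, abs_of_pos hκ0]
        exact mul_le_mul_of_nonneg_left (hTb w hw) hκ0.le
      linarith
    · intro w hw
      rw [hbd w hw]
      apply le_of_eq; ring
  have k1 := key 1 (by simp)
  have k2 := key (-1) (by simp)
  rw [← hGp z hz]
  linarith

end PoissonSemigroup

section Reproducing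

variable {n : ℕ}

/-- the growth condition `|f(x,t)| ≤ M t^{-λ}` -/
def GrowthBound (f : Euc (n + 1) → ℝ) (lam M : ℝ) : Prop :=
  ∀ z, 0 < tp z → |f z| ≤ M * tp z ^ (-lam)

variable {f : Euc (n + 1) → ℝ} {lam M : ℝ}

lemma GrowthBound.nonneg (hM : GrowthBound f lam M) : 0 ≤ M := by
  have h := hM (pt 0 1) (by simp)
  rw [tp_pt, one_rpow, mul_one] at h
  exact (abs_nonneg _).trans h

lemma GrowthBound.le_of_le (hM : GrowthBound f lam M) (hl : 0 < lam) {s : ℝ} (hs : 0 < s)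
    (z : Euc (n + 1)) (hz : s ≤ tp z) : |f z| ≤ M * s ^ (-lam) :=
  (hM z (hs.trans_le hz)).trans (mul_le_mul_of_nonneg_left
    (rpow_le_rpow_of_nonpos hs hz (by linarith)) hM.nonneg)

lemma integrable_mul_poissonDeriv {g : Euc n → ℝ} (hg : Continuous g) {B : ℝ}
    (hB : ∀ y, |g y| ≤ B) (j : ℕ) {z : Euc (n + 1)} (hz : 0 < tp z) :
    Integrable (fun y : Euc n => g y * poissonDeriv n j (z - pt y 0)) := by
  rcases Nat.eq_zero_or_pos j with rfl | hj
  · exact integrable_mul_poissonFun hg hB hz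
  · have hj' : (0 : ℝ) < j := by exact_mod_cast hj
    obtain ⟨C, hC0, hC⟩ := (isHomog_poissonDeriv n j).bound
    have hc : Continuous fun y : Euc n => z - pt y 0 := by fun_prop
    have hne : ∀ y : Euc n, z - pt y 0 ≠ 0 := fun y =>
      ne_zero_of_tp_pos (by rw [tp_sub, tp_pt]; linarith)
    refine ((integrable_mul_norm_rpow hg hB (r := n + j) (by linarith) hz).const_mul C).mono'
      (hg.measurable.mul ((isHomog_poissonDeriv n j).measurable.comp
        hc.measurable)).aestronglyMeasurable (Filter.Eventually.of_forall fun y => ?_)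
    rw [norm_mul, Real.norm_eq_abs]
    have := hC _ (hne y)
    calc |g y| * ‖poissonDeriv n j (z - pt y 0)‖ ≤ |g y| * (C * ‖z - pt y 0‖ ^ (-((n : ℝ) + j))) := by
          gcongr
      _ = _ := by ring

lemma verticalDeriv_aux (hf : HarmonicOnE f (upperHS n)) (hl : 0 < lam)
    (hM : GrowthBound f lam M) (x : Euc n) (j : ℕ)
    (ih : ∀ {t s : ℝ}, 0 < t → 0 < s → poissonMass n * iteratedDeriv j (fun u => f (pt x u)) (t + s)
      = ∫ y : Euc n, f (pt y s) * poissonDeriv n j (pt x t - pt y 0)) {t s : ℝ} (ht : 0 < t)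
    (hs : 0 < s) :
    HasDerivAt (fun u => poissonMass n * iteratedDeriv j (fun u => f (pt x u)) u)
      (∫ y : Euc n, f (pt y s) * poissonDeriv n (j + 1) (pt x t - pt y 0)) (t + s) := by
  have hgc := continuousOn_slice hf hs
  have hgM : ∀ y : Euc n, |f (pt y s)| ≤ M * s ^ (-lam) := fun y =>
    hM.le_of_le hl hs _ (by simp)
  have h := hasDerivAt_potential (n := n) (a := fun y : Euc n => f (pt y s))
    (b := fun y : Euc n => pt y 0) (μ := volume) hgc.aestronglyMeasurable (by fun_prop)
    (Filter.Eventually.of_forall fun y => by simp) (j := j) (x := x) ht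
    (integrable_mul_poissonDeriv hgc hgM j (by simpa using ht))
    (integrable_mul_norm_rpow hgc hgM (by
      have : (0 : ℝ) ≤ j := by positivity
      linarith) (by simpa using ht))
  have h' : HasDerivAt (fun u => ∫ y : Euc n, f (pt y s) * poissonDeriv n j (pt x u - pt y 0))
      (∫ y : Euc n, f (pt y s) * poissonDeriv n (j + 1) (pt x t - pt y 0)) (t + s - s) := by
    rwa [add_sub_cancel_right]
  refine (h'.comp_sub_const (t + s) s).congr_of_eventuallyEq ?_
  filter_upwards [lt_mem_nhds (show s < t + s by linarith)] with u hu
  rw [← ih (by linarith) hs, sub_add_cancel]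

lemma verticalDeriv_eq (hf : HarmonicOnE f (upperHS n)) (hl : 0 < lam)
    (hM : GrowthBound f lam M) (x : Euc n) (j : ℕ) {t s : ℝ} (ht : 0 < t) (hs : 0 < s) :
    poissonMass n * iteratedDeriv j (fun u => f (pt x u)) (t + s)
      = ∫ y : Euc n, f (pt y s) * poissonDeriv n j (pt x t - pt y 0) := by
  induction j generalizing t s with
  | zero =>
    have h := poisson_semigroup hf hs (hM.le_of_le hl hs) (z := pt x t) (by simpa using ht)
    rw [pt_add, add_zero] at h
    simpa [poissonDeriv] using h.symm
  | succ j ih =>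
    rw [← (verticalDeriv_aux hf hl hM x j ih ht hs).deriv, iteratedDeriv_succ,
      deriv_const_mul_field]

lemma hasDerivAt_verticalDeriv (hf : HarmonicOnE f (upperHS n)) (hl : 0 < lam)
    (hM : GrowthBound f lam M) (x : Euc n) (j : ℕ) {u : ℝ} (hu : 0 < u) :
    HasDerivAt (iteratedDeriv j (fun u => f (pt x u)))
      (iteratedDeriv (j + 1) (fun u => f (pt x u)) u) u := by
  have h := verticalDeriv_aux hf hl hM x j
    (fun {t s} => verticalDeriv_eq hf hl hM x j) (half_pos hu) (half_pos hu)
  rw [← verticalDeriv_eq hf hl hM x (j + 1) (half_pos hu) (half_pos hu), add_halves] at h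
  have h2 := h.const_mul (poissonMass n)⁻¹
  have hκ := (poissonMass_pos n).ne'
  simpa [inv_mul_cancel_left₀ hκ] using h2

lemma verticalDeriv_bound (hf : HarmonicOnE f (upperHS n)) (hl : 0 < lam)
    (hM : GrowthBound f lam M) (x : Euc n) (j : ℕ) :
    ∃ C, ∀ u : ℝ, 0 < u → u ^ j * |iteratedDeriv j (fun u => f (pt x u)) u| ≤ C * u ^ (-lam) := by
  rcases Nat.eq_zero_or_pos j with rfl | hj
  · refine ⟨M, fun u hu => ?_⟩
    simpa using hM (pt x u) (by simpa using hu)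
  · have hj' : (0 : ℝ) < j := by exact_mod_cast hj
    obtain ⟨C, hC0, hC⟩ := (isHomog_poissonDeriv n j).bound
    set I := ∫ v : Euc n, ‖pt v 1‖ ^ (-((n : ℝ) + j)) with hI
    have hκ := poissonMass_pos n
    refine ⟨(poissonMass n)⁻¹ * (M * C * I * (1 / 2) ^ (-lam) * (1 / 2) ^ (-(j : ℝ))),
      fun u hu => ?_⟩
    have hu2 := half_pos hu
    have hgM : ∀ y : Euc n, |f (pt y (u / 2))| ≤ M * (u / 2) ^ (-lam) := fun y =>
      hM.le_of_le hl hu2 _ (by simp)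
    have h := verticalDeriv_eq hf hl hM x j hu2 hu2
    rw [add_halves] at h
    have hb : |∫ y : Euc n, f (pt y (u / 2)) * poissonDeriv n j (pt x (u / 2) - pt y 0)|
        ≤ ∫ y : Euc n, (M * (u / 2) ^ (-lam) * C) * ‖pt (x - y) (u / 2)‖ ^ (-((n : ℝ) + j)) := by
      rw [← Real.norm_eq_abs]
      refine norm_integral_le_of_norm_le
        ((integrable_norm_pt (by linarith) hu2 x).const_mul _)
        (Filter.Eventually.of_forall fun y => ?_)
      rw [pt_sub, sub_zero, norm_mul, Real.norm_eq_abs, mul_assoc]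
      exact mul_le_mul (hgM y) (hC _ (ne_zero_of_tp_pos (by simpa using hu)))
        (norm_nonneg _) ((abs_nonneg _).trans (hgM y))
    rw [integral_const_mul, integral_norm_pt hu2 x, ← h, abs_mul, abs_of_pos hκ] at hb
    have e1 : (n : ℝ) - (n + j) = -(j : ℝ) := by ring
    rw [e1, ← hI, div_eq_mul_one_div u 2, mul_rpow hu.le (by norm_num),
      mul_rpow hu.le (by norm_num)] at hb
    have e2 : u ^ (-(j : ℝ)) = (u ^ j)⁻¹ := by rw [rpow_neg hu.le, rpow_natCast]
    rw [e2] at hb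
    have hb2 := mul_le_mul_of_nonneg_left hb (by positivity : 0 ≤ (poissonMass n)⁻¹ * u ^ j)
    calc _ = (poissonMass n)⁻¹ * u ^ j *
          (poissonMass n * |iteratedDeriv j (fun u => f (pt x u)) u|) := by field_simp
      _ ≤ _ := hb2
      _ = _ := by field_simp

lemma aestronglyMeasurable_halfVol (hf : HarmonicOnE f (upperHS n)) :
    AEStronglyMeasurable (fun w : Euc n × ℝ => f (pt w.1 w.2)) (halfVol n) := by
  rw [halfVol_eq]
  refine ContinuousOn.aestronglyMeasurable ?_ (MeasurableSet.univ.prod measurableSet_Ioi)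
  exact hf.1.continuousOn.comp (by fun_prop) fun w hw => pt_mem_upperHS.2 hw.2

lemma abs_mul_pow_le (hM : GrowthBound f lam M) (m : ℕ) {w : Euc n × ℝ} (hw : 0 < w.2) :
    |f (pt w.1 w.2) * w.2 ^ m| ≤ M * w.2 ^ ((m : ℝ) - lam) := by
  rw [abs_mul, abs_of_pos (pow_pos hw m), sub_eq_neg_add, rpow_add hw, rpow_natCast, ← mul_assoc]
  have := hM (pt w.1 w.2) (by simpa using hw)
  rw [tp_pt] at this
  gcongr

lemma ne_zero_of_pos {x : Euc n} {t : ℝ} (ht : 0 < t) {w : Euc n × ℝ} (hw : 0 < w.2) :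
    pt x t - pt w.1 (-w.2) ≠ 0 :=
  ne_zero_of_tp_pos (by rw [tp_sub, tp_pt, tp_pt]; linarith)

/-- Integrability of the densities in the reproducing formula against kernels of
homogeneity `-r`. -/
lemma integrable_mul_pow_mul_norm (hf : HarmonicOnE f (upperHS n)) (hl : 0 < lam)
    (hM : GrowthBound f lam M) {m : ℕ} (hm : lam - 1 < m) {r : ℝ} (hr : (n : ℝ) + m + 1 ≤ r)
    (x : Euc n) {t : ℝ} (ht : 0 < t) :
    Integrable (fun w : Euc n × ℝ => |f (pt w.1 w.2) * w.2 ^ m| *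
      ‖pt x t - pt w.1 (-w.2)‖ ^ (-r)) (halfVol n) := by
  have hc : Continuous fun w : Euc n × ℝ => pt w.1 (-w.2) := by fun_prop
  refine ((integrable_kernel_weight (γ := (m : ℝ) - lam) (r := r) (by linarith) (by linarith) ht
    x).const_mul M).mono' ?_ ?_
  · exact (((aestronglyMeasurable_halfVol hf).mul
      (measurable_snd.pow_const m).aestronglyMeasurable).norm).mul
      (((hc.measurable.const_sub _).norm).pow_const _).aestronglyMeasurable
  · filter_upwards [ae_halfVol_pos n] with w hw
    rw [Real.norm_of_nonneg (by positivity), ← mul_assoc]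
    gcongr
    exact abs_mul_pow_le hM m hw

lemma integrable_mul_pow_mul_poissonDeriv (hf : HarmonicOnE f (upperHS n)) (hl : 0 < lam)
    (hM : GrowthBound f lam M) {m : ℕ} (hm : lam - 1 < m) (x : Euc n) {t : ℝ} (ht : 0 < t) :
    Integrable (fun w : Euc n × ℝ => f (pt w.1 w.2) * w.2 ^ m *
      poissonDeriv n (m + 1) (pt x t - pt w.1 (-w.2))) (halfVol n) := by
  obtain ⟨C, hC0, hC⟩ := (isHomog_poissonDeriv n (m + 1)).bound
  have hc : Continuous fun w : Euc n × ℝ => pt w.1 (-w.2) := by fun_prop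
  refine ((integrable_mul_pow_mul_norm hf hl hM hm (r := (n : ℝ) + (m + 1 : ℕ))
    (by push_cast; linarith) x ht).const_mul C).mono' ?_ ?_
  · exact ((aestronglyMeasurable_halfVol hf).mul
      (measurable_snd.pow_const m).aestronglyMeasurable).mul
      ((isHomog_poissonDeriv n (m + 1)).measurable.comp
        (hc.measurable.const_sub _)).aestronglyMeasurable
  · filter_upwards [ae_halfVol_pos n] with w hw
    rw [norm_mul, Real.norm_eq_abs]
    calc _ ≤ |f (pt w.1 w.2) * w.2 ^ m| * (C * ‖pt x t - pt w.1 (-w.2)‖ ^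
          (-((n : ℝ) + (m + 1 : ℕ)))) := by
          gcongr
          exact hC _ (ne_zero_of_pos ht hw)
      _ = _ := by ring

lemma hasDerivAt_taylorSum (hf : HarmonicOnE f (upperHS n)) (hl : 0 < lam)
    (hM : GrowthBound f lam M) (x : Euc n) (m : ℕ) {t s : ℝ} (h : 0 < t + 2 * s) :
    HasDerivAt (fun s => ∑ i ∈ Finset.range (m + 1), (-2 : ℝ) ^ i / (i.factorial : ℝ) * s ^ i *
        iteratedDeriv i (fun u => f (pt x u)) (t + 2 * s))
      (-((-2 : ℝ) ^ (m + 1) / (m.factorial : ℝ)) * s ^ m *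
        iteratedDeriv (m + 1) (fun u => f (pt x u)) (t + 2 * s)) s := by
  have hd : ∀ i, HasDerivAt (fun s => iteratedDeriv i (fun u => f (pt x u)) (t + 2 * s))
      (iteratedDeriv (i + 1) (fun u => f (pt x u)) (t + 2 * s) * 2) s := by
    intro i
    have h2 : HasDerivAt (fun s : ℝ => t + 2 * s) 2 s := by
      simpa using ((hasDerivAt_id s).const_mul 2).const_add t
    exact (hasDerivAt_verticalDeriv hf hl hM x i h).comp s h2
  induction m with
  | zero =>
    have := hd 0
    simp only [zero_add, Finset.range_one, Finset.sum_singleton, pow_zero, Nat.factorial_zero,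
      Nat.cast_one, div_one, one_mul, pow_one, mul_one] at this ⊢
    convert this using 1
    ring
  | succ m ih =>
    have h3 := (((hasDerivAt_pow (m + 1) s).const_mul
      ((-2 : ℝ) ^ (m + 1) / ((m + 1).factorial : ℝ))).mul (hd (m + 1)))
    refine HasDerivAt.congr_of_eventuallyEq ((ih.add h3).congr_deriv ?_)
      (Filter.Eventually.of_forall fun s => Finset.sum_range_succ _ _)
    have : ((m + 1).factorial : ℝ) = (m + 1) * m.factorial := by
      rw [Nat.factorial_succ]; push_cast; ring
    rw [this]
    have : (m.factorial : ℝ) ≠ 0 := by positivity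
    have : (m : ℝ) + 1 ≠ 0 := by positivity
    push_cast
    field_simp
    ring

/-- The reproducing formula of the harmonic Bergman kernel on functions of growth `t^{-λ}`. -/
lemma integral_bergman_eq (hf : HarmonicOnE f (upperHS n)) (hl : 0 < lam)
    (hM : GrowthBound f lam M) {m : ℕ} (hm : lam - 1 < m) (x : Euc n) {t : ℝ} (ht : 0 < t) :
    ((-2 : ℝ) ^ (m + 1) / (m.factorial : ℝ)) * ∫ w : Euc n × ℝ, f (pt w.1 w.2) * w.2 ^ m *
      poissonDeriv n (m + 1) (pt x t - pt w.1 (-w.2)) ∂(halfVol n)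
      = poissonMass n * f (pt x t) := by
  have hint := integrable_mul_pow_mul_poissonDeriv hf hl hM hm x ht
  set D := fun j u => iteratedDeriv j (fun u => f (pt x u)) u with hD
  have hinner : ∀ s : ℝ, 0 < s → ∫ y : Euc n, f (pt y s) * s ^ m *
      poissonDeriv n (m + 1) (pt x t - pt y (-s))
      = poissonMass n * (s ^ m * D (m + 1) (t + 2 * s)) := by
    intro s hs
    have h := verticalDeriv_eq hf hl hM x (m + 1) (add_pos ht hs) hs
    have e : t + s + s = t + 2 * s := by ring
    rw [e] at h
    simp only [hD]
    rw [mul_left_comm, h, ← integral_const_mul]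
    refine integral_congr_ae (Filter.Eventually.of_forall fun y => ?_)
    simp only [pt_sub, sub_zero, sub_neg_eq_add]
    ring
  have hint2 : IntegrableOn (fun s : ℝ => poissonMass n * (s ^ m * D (m + 1) (t + 2 * s)))
      (Ioi 0) := by
    refine (hint.integral_prod_right).congr ?_
    filter_upwards [ae_restrict_mem measurableSet_Ioi] with s hs
    exact hinner s hs
  have hκ := poissonMass_pos n
  have hint3 : IntegrableOn (fun s : ℝ => -((-2 : ℝ) ^ (m + 1) / (m.factorial : ℝ)) * s ^ m *
        D (m + 1) (t + 2 * s)) (Ioi 0) := by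
    refine (hint2.const_mul (-((-2 : ℝ) ^ (m + 1) / (m.factorial : ℝ)) *
      (poissonMass n)⁻¹)).congr (Filter.Eventually.of_forall fun s => ?_)
    simp only
    field_simp
  have hlim : Filter.Tendsto (fun s => ∑ i ∈ Finset.range (m + 1),
      (-2 : ℝ) ^ i / (i.factorial : ℝ) * s ^ i * D i (t + 2 * s)) Filter.atTop (nhds 0) := by
    suffices hi : ∀ i ∈ Finset.range (m + 1), Filter.Tendsto (fun s =>
        (-2 : ℝ) ^ i / (i.factorial : ℝ) * s ^ i * D i (t + 2 * s)) Filter.atTop (nhds 0) by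
      simpa using tendsto_finsetSum _ hi
    intro i _
    obtain ⟨C, hC⟩ := verticalDeriv_bound hf hl hM x i
    have hlin : Filter.Tendsto (fun s : ℝ => t + 2 * s) Filter.atTop Filter.atTop :=
      Filter.tendsto_atTop_add_const_left _ _ (Filter.tendsto_id.const_mul_atTop (by norm_num))
    have h0 : Filter.Tendsto (fun s : ℝ => |(-2 : ℝ) ^ i / (i.factorial : ℝ)| *
        (C * (t + 2 * s) ^ (-lam))) Filter.atTop (nhds 0) := by
      simpa using (((tendsto_rpow_neg_atTop hl).comp hlin).const_mul C).const_mul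
        |(-2 : ℝ) ^ i / (i.factorial : ℝ)|
    refine squeeze_zero_norm' ?_ h0
    filter_upwards [Filter.eventually_gt_atTop 0] with s hs
    rw [Real.norm_eq_abs, mul_assoc, abs_mul, abs_mul, abs_of_pos (pow_pos hs i)]
    refine mul_le_mul_of_nonneg_left ?_ (abs_nonneg _)
    refine le_trans ?_ (hC (t + 2 * s) (by positivity))
    gcongr
    linarith
  have hFTC := integral_Ioi_of_hasDerivAt_of_tendsto' (a := (0 : ℝ))
    (fun s (hs : 0 ≤ s) => hasDerivAt_taylorSum hf hl hM x m (t := t) (s := s) (by positivity))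
    hint3 hlim
  rw [integral_prod_symm _ hint, setIntegral_congr_fun measurableSet_Ioi fun s hs => hinner s hs,
    integral_const_mul]
  simp_rw [mul_assoc] at hFTC
  rw [integral_const_mul] at hFTC
  rw [Finset.sum_range_succ'] at hFTC
  simp only [hD] at hFTC ⊢
  simp at hFTC
  rw [mul_left_comm, hFTC]

end Reproducing

section UpperEstimate

variable {n : ℕ} {f : Euc (n + 1) → ℝ} {lam M : ℝ}

lemma growthBound_of_supNormE_lt_top (h : supNormE n f lam < ⊤) :
    GrowthBound f lam (supNormE n f lam).toReal := by
  intro z hz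
  have h1 : ENNReal.ofReal (tp z ^ lam * |f z|) ≤ supNormE n f lam := by
    unfold supNormE
    refine le_iSup₂_of_le (xp z, tp z) hz ?_
    simp only [pt_xp_tp, le_refl]
  have h2 := (ENNReal.ofReal_le_iff_le_toReal h.ne).1 h1
  rw [rpow_neg hz.le, ← div_eq_mul_inv, le_div_iff₀ (by positivity), mul_comm]
  exact h2

lemma supNormE_le {K : ℝ} (h : ∀ (x : Euc n) (t : ℝ), 0 < t → t ^ lam * |f (pt x t)| ≤ K) :
    supNormE n f lam ≤ ENNReal.ofReal K :=
  iSup₂_le fun v hv => ENNReal.ofReal_le_ofReal (h v.1 v.2 hv)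

lemma measurableSet_Vset (hf : HarmonicOnE f (upperHS n)) (ε : ℝ) :
    MeasurableSet (Vset n f lam ε) := by
  set S : Set (Euc n × ℝ) := univ ×ˢ Ioi 0 with hS
  have hSo : IsOpen S := isOpen_univ.prod isOpen_Ioi
  have hc : ContinuousOn (fun v : Euc n × ℝ => |f (pt v.1 v.2)| * v.2 ^ lam) S := by
    have h1 : ContinuousOn (fun w : Euc n × ℝ => f (pt w.1 w.2)) S :=
      hf.1.continuousOn.comp (by fun_prop) fun w hw => pt_mem_upperHS.2 hw.2
    exact h1.abs.mul (continuousOn_snd.rpow_const fun v hv => Or.inl (ne_of_gt hv.2))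
  have h := hc.isOpen_inter_preimage hSo (isOpen_Iio (a := ε))
  have : Vset n f lam ε = S \ (S ∩ (fun v : Euc n × ℝ => |f (pt v.1 v.2)| * v.2 ^ lam) ⁻¹' Iio ε) := by
    ext v
    simp only [Vset, mem_ofPred_eq, hS, mem_sdiff, mem_inter_iff, mem_preimage, mem_Iio, mem_prod,
      mem_univ, true_and, mem_Ioi, not_and, not_lt]
    tauto
  rw [this]
  exact hSo.measurableSet.diff h.measurableSet

lemma restrict_Vset (ε : ℝ) : (halfVol n).restrict (Vset n f lam ε) =
    ((volume : Measure (Euc n)).prod (volume : Measure ℝ)).restrict (Vset n f lam ε) := by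
  rw [halfVol_eq, Measure.restrict_restrict_of_subset]
  exact fun v hv => ⟨mem_univ _, hv.1⟩

/-- the part of the reproducing formula coming from a set `V` -/
def bergmanPart (n m : ℕ) (f : Euc (n + 1) → ℝ) (V : Set (Euc n × ℝ)) (z : Euc (n + 1)) : ℝ :=
  ∫ w : Euc n × ℝ in V, ((poissonMass n)⁻¹ * ((-2 : ℝ) ^ (m + 1) / (m.factorial : ℝ)) *
    (f (pt w.1 w.2) * w.2 ^ m)) * poissonDeriv n (m + 1) (z - pt w.1 (-w.2)) ∂(halfVol n)

lemma integrable_bergmanPart (hf : HarmonicOnE f (upperHS n)) (hl : 0 < lam)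
    (hM : GrowthBound f lam M) {m : ℕ} (hm : lam - 1 < m) {z : Euc (n + 1)} (hz : 0 < tp z) :
    Integrable (fun w : Euc n × ℝ =>
      ((poissonMass n)⁻¹ * ((-2 : ℝ) ^ (m + 1) / (m.factorial : ℝ)) *
      (f (pt w.1 w.2) * w.2 ^ m)) * poissonDeriv n (m + 1) (z - pt w.1 (-w.2))) (halfVol n) := by
  have h := integrable_mul_pow_mul_poissonDeriv hf hl hM hm (xp z) hz
  rw [pt_xp_tp] at h
  simpa only [mul_assoc] using h.const_mul
    ((poissonMass n)⁻¹ * ((-2 : ℝ) ^ (m + 1) / (m.factorial : ℝ)))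

lemma harmonicOnE_bergmanPart (hf : HarmonicOnE f (upperHS n)) (hl : 0 < lam)
    (hM : GrowthBound f lam M) {m : ℕ} (hm : lam - 1 < m) (V : Set (Euc n × ℝ)) :
    HarmonicOnE (bergmanPart n m f V) (upperHS n) := by
  unfold bergmanPart
  refine harmonicOnE_potential (μ := (halfVol n).restrict V) (d := (n : ℝ) + (m + 1 : ℕ))
    (a := fun w : Euc n × ℝ => (poissonMass n)⁻¹ * ((-2 : ℝ) ^ (m + 1) / (m.factorial : ℝ)) *
      (f (pt w.1 w.2) * w.2 ^ m)) (b := fun w : Euc n × ℝ => pt w.1 (-w.2))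
    (k := poissonDeriv n (m + 1))
    ?_ (by fun_prop) ?_ (isHomog_poissonDeriv n (m + 1)) (by positivity)
    (harmonic_poissonDeriv n (m + 1)) ?_ ?_
  · exact (((aestronglyMeasurable_halfVol hf).mul
      (measurable_snd.pow_const m).aestronglyMeasurable).const_mul _).restrict
  · refine ae_restrict_of_ae ?_
    filter_upwards [ae_halfVol_pos n] with w hw
    rw [tp_pt]; linarith
  · exact fun z hz => (integrable_bergmanPart hf hl hM hm hz).restrict
  · intro z hz
    have h := integrable_mul_pow_mul_norm hf hl hM hm (r := (n : ℝ) + (m + 1 : ℕ) + 1)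
      (by push_cast; linarith) (xp z) hz
    rw [pt_xp_tp] at h
    refine ((h.const_mul |(poissonMass n)⁻¹ * ((-2 : ℝ) ^ (m + 1) / (m.factorial : ℝ))|).congr
      (Filter.Eventually.of_forall fun w => ?_)).restrict
    simp only
    rw [abs_mul ((poissonMass n)⁻¹ * ((-2 : ℝ) ^ (m + 1) / (m.factorial : ℝ))), mul_assoc]

lemma ofReal_abs_bergmanPart_le (hM : GrowthBound f lam M) (m : ℕ) (ε : ℝ) (x : Euc n) {t : ℝ}
    (ht : 0 < t) :
    ENNReal.ofReal |bergmanPart n m f (Vset n f lam ε) (pt x t)| ≤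
      ENNReal.ofReal ((poissonMass n)⁻¹ * M) * ∫⁻ w : Euc n × ℝ in Vset n f lam ε,
        ENNReal.ofReal (|Qker n m x t w.1 w.2| * w.2 ^ ((m : ℝ) - lam))
        ∂((volume : Measure (Euc n)).prod (volume : Measure ℝ)) := by
  have hκ := poissonMass_pos n
  rw [← restrict_Vset, ← Real.norm_eq_abs, ofReal_norm,
    ← lintegral_const_mul' _ _ ENNReal.ofReal_ne_top]
  refine (enorm_integral_le_lintegral_enorm _).trans (lintegral_mono_ae (ae_restrict_of_ae ?_))
  filter_upwards [ae_halfVol_pos n] with w hw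
  rw [← ofReal_norm, ← ENNReal.ofReal_mul (mul_nonneg (by positivity) hM.nonneg)]
  refine ENNReal.ofReal_le_ofReal ?_
  rw [Qker_eq m x w.1 (add_pos ht hw), norm_mul, norm_mul, norm_mul, norm_inv,
    Real.norm_of_nonneg hκ.le, Real.norm_eq_abs, Real.norm_eq_abs, Real.norm_eq_abs]
  set c := (-2 : ℝ) ^ (m + 1) / (m.factorial : ℝ)
  set k := poissonDeriv n (m + 1) (pt x t - pt w.1 (-w.2))
  rw [abs_mul c]
  calc (poissonMass n)⁻¹ * |c| * |f (pt w.1 w.2) * w.2 ^ m| * |k|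
      ≤ (poissonMass n)⁻¹ * |c| * (M * w.2 ^ ((m : ℝ) - lam)) * |k| := by
        gcongr
        exact abs_mul_pow_le hM m hw
    _ = _ := by ring

lemma memAp_bergmanPart (hf : HarmonicOnE f (upperHS n)) (hl : 0 < lam)
    (hM : GrowthBound f lam M) {m : ℕ} (hm : lam - 1 < m) {p α ε : ℝ} (hp : 0 < p)
    (hε : distTwoInt n m f lam α p ε < ⊤) :
    memAp n (bergmanPart n m f (Vset n f lam ε)) p α := by
  refine ⟨harmonicOnE_bergmanPart hf hl hM hm _, ?_⟩
  have hmeas : Measurable fun zt : Euc n × ℝ => ENNReal.ofReal (zt.2 ^ α) :=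
    (measurable_snd.pow_const _).ennreal_ofReal
  refine (lintegral_withDensity_le_lintegral_mul _ hmeas _).trans_lt ?_
  have hc : ENNReal.ofReal ((poissonMass n)⁻¹ * M) ^ p ≠ ⊤ :=
    ENNReal.rpow_ne_top_of_nonneg hp.le ENNReal.ofReal_ne_top
  refine lt_of_le_of_lt ?_ (ENNReal.mul_lt_top hc.lt_top hε)
  rw [distTwoInt, ← halfVol_eq, ← lintegral_const_mul' _ _ hc]
  refine lintegral_mono_ae ?_
  filter_upwards [ae_halfVol_pos n] with z hz
  rw [Pi.mul_apply, ← ENNReal.ofReal_rpow_of_nonneg (abs_nonneg _) hp.le, mul_comm, ← mul_assoc,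
    ← ENNReal.mul_rpow_of_nonneg _ _ hp.le]
  gcongr
  exact ofReal_abs_bergmanPart_le hM m ε z.1 hz

lemma exists_supNormE_sub_bergmanPart_le (n m : ℕ) (hl : 0 < lam) (hm : lam - 1 < m) :
    ∃ C : ℝ, 0 < C ∧ ∀ (f : Euc (n + 1) → ℝ) (M ε : ℝ), HarmonicOnE f (upperHS n) →
      GrowthBound f lam M → 0 < ε →
      supNormE n (fun z => f z - bergmanPart n m f (Vset n f lam ε) z) lam
        ≤ ENNReal.ofReal (C * ε) := by
  obtain ⟨B, hB0, hB⟩ := (isHomog_poissonDeriv n (m + 1)).bound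
  set K := (poissonMass n)⁻¹ * ((-2 : ℝ) ^ (m + 1) / (m.factorial : ℝ)) with hK
  set r := (n : ℝ) + (m + 1 : ℕ) with hr
  set I := (∫ s in Ioi (0 : ℝ), s ^ ((m : ℝ) - lam) * (1 + s) ^ (-(r - n)))
        * ∫ v : Euc n, ‖pt v 1‖ ^ (-r) with hI
  have hI0 : 0 ≤ I := by
    refine mul_nonneg (setIntegral_nonneg measurableSet_Ioi fun s hs => ?_)
      (integral_nonneg fun v => by positivity)
    have : 0 < s := hs
    positivity
  refine ⟨|K| * B * I + 1, by positivity, fun f M ε hf hM hε => supNormE_le fun x t ht => ?_⟩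
  have hint := integrable_bergmanPart hf hl hM hm (z := pt x t) (by simpa using ht)
  have h1 := integral_add_compl (measurableSet_Vset (lam := lam) hf ε) hint
  have h2 : ∫ w : Euc n × ℝ, (K * (f (pt w.1 w.2) * w.2 ^ m)) *
      poissonDeriv n (m + 1) (pt x t - pt w.1 (-w.2)) ∂(halfVol n) = f (pt x t) := by
    have h3 := integral_bergman_eq hf hl hM hm x ht
    simp_rw [mul_assoc K]
    rw [integral_const_mul, hK, mul_assoc, h3, inv_mul_cancel_left₀ (poissonMass_pos n).ne']
  have h4 : f (pt x t) - bergmanPart n m f (Vset n f lam ε) (pt x t)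
      = ∫ w : Euc n × ℝ in (Vset n f lam ε)ᶜ, (K * (f (pt w.1 w.2) * w.2 ^ m)) *
        poissonDeriv n (m + 1) (pt x t - pt w.1 (-w.2)) ∂(halfVol n) := by
    rw [← h2, ← h1, bergmanPart, add_sub_cancel_left]
  have hw := integrable_kernel_weight (n := n) (γ := (m : ℝ) - lam) (r := r) (by linarith)
    (by rw [hr]; push_cast; linarith) ht x
  have h5 : |f (pt x t) - bergmanPart n m f (Vset n f lam ε) (pt x t)|
      ≤ |K| * B * ε * (t ^ (-lam) * I) := by
    have e : t ^ (-lam) * I = ∫ w : Euc n × ℝ, w.2 ^ ((m : ℝ) - lam) *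
        ‖pt x t - pt w.1 (-w.2)‖ ^ (-r) ∂(halfVol n) := by
      rw [integral_kernel_weight (by linarith) (by rw [hr]; push_cast; linarith) ht x]
      congr 2
      rw [hr]; push_cast; ring
    rw [h4, ← Real.norm_eq_abs, e, ← integral_const_mul]
    refine (norm_integral_le_of_norm_le (hw.const_mul (|K| * B * ε)).restrict ?_).trans
      (setIntegral_le_integral (hw.const_mul (|K| * B * ε)) ?_)
    · filter_upwards [ae_restrict_mem (measurableSet_Vset (lam := lam) hf ε).compl,
        ae_restrict_of_ae (ae_halfVol_pos n)] with w hwV hw0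
      have hlt : |f (pt w.1 w.2)| * w.2 ^ lam < ε := by
        by_contra hcon
        exact hwV ⟨hw0, not_lt.1 hcon⟩
      have h6 : |f (pt w.1 w.2)| ≤ ε * w.2 ^ (-lam) := by
        rw [rpow_neg hw0.le, ← div_eq_mul_inv, le_div_iff₀ (by positivity)]
        exact hlt.le
      rw [norm_mul, norm_mul K, norm_mul (f _), Real.norm_eq_abs K, Real.norm_eq_abs (f _),
        Real.norm_of_nonneg (by positivity : 0 ≤ w.2 ^ m)]
      have h7 := hB _ (ne_zero_of_pos (x := x) ht hw0)
      calc |K| * (|f (pt w.1 w.2)| * w.2 ^ m) *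
            ‖poissonDeriv n (m + 1) (pt x t - pt w.1 (-w.2))‖
          ≤ |K| * ((ε * w.2 ^ (-lam)) * w.2 ^ m) *
            (B * ‖pt x t - pt w.1 (-w.2)‖ ^ (-r)) := by gcongr
        _ = _ := by
          rw [sub_eq_neg_add (m : ℝ), rpow_add hw0, rpow_natCast]
          ring
    · filter_upwards [ae_halfVol_pos n] with w hw0
      simp only [Pi.zero_apply]
      positivity
  calc t ^ lam * |f (pt x t) - bergmanPart n m f (Vset n f lam ε) (pt x t)|
      ≤ t ^ lam * (|K| * B * ε * (t ^ (-lam) * I)) := by gcongr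
    _ = |K| * B * I * ε := by
        have : t ^ lam * t ^ (-lam) = 1 := by rw [← rpow_add ht, add_neg_cancel, rpow_zero]
        linear_combination (|K| * B * ε * I) * this
    _ ≤ _ := by nlinarith

lemma exists_distOne_le (n m : ℕ) (hl : 0 < lam) (hm : lam - 1 < m) {p α : ℝ} (hp : 0 < p) :
    ∃ C : ℝ, 0 < C ∧ ∀ f : Euc (n + 1) → ℝ, HarmonicOnE f (upperHS n) → supNormE n f lam < ⊤ →
      distOne n p α lam f ≤ ENNReal.ofReal C * distTwo n m f lam α p := by
  obtain ⟨C, hC0, hC⟩ := exists_supNormE_sub_bergmanPart_le n m hl hm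
  refine ⟨C, hC0, fun f hf hfin => ?_⟩
  have hM := growthBound_of_supNormE_lt_top hfin
  have hne : ENNReal.ofReal C ≠ 0 := (ENNReal.ofReal_pos.2 hC0).ne'
  rw [← ENNReal.div_le_iff' hne ENNReal.ofReal_ne_top]
  refine le_iInf₂ fun ε hε => ?_
  rw [ENNReal.div_le_iff' hne ENNReal.ofReal_ne_top, ← ENNReal.ofReal_mul hC0.le]
  unfold distOne
  exact (iInf₂_le (bergmanPart n m f (Vset n f lam ε))
    (memAp_bergmanPart hf hl hM hm hp hε.2)).trans (hC f _ ε hf hM hε.1)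

end UpperEstimate

section Decay

variable {n : ℕ} {g : Euc (n + 1) → ℝ} {lam M p α : ℝ}

lemma lintegral_rpow_mul_rpow_lt_top (hg : memAp n g p α) :
    ∫⁻ w : Euc n × ℝ, ENNReal.ofReal (|g (pt w.1 w.2)| ^ p) * ENNReal.ofReal (w.2 ^ α)
      ∂(halfVol n) < ⊤ := by
  have h := hg.2
  have hm : Measurable fun zt : Euc n × ℝ => ENNReal.ofReal (zt.2 ^ α) :=
    (measurable_snd.pow_const _).ennreal_ofReal
  have hm2 : AEMeasurable (fun w : Euc n × ℝ => ENNReal.ofReal (|g (pt w.1 w.2)| ^ p))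
      (halfVol n) :=
    ((aestronglyMeasurable_halfVol hg.1).aemeasurable.abs.pow_const p).ennreal_ofReal
  rw [normAp, mLam, lintegral_withDensity_eq_lintegral_mul₀ hm.aemeasurable hm2] at h
  simpa only [Pi.mul_apply, mul_comm] using h

lemma self_le_rpow_mul_rpow {a b : ℝ} (hp0 : 0 < p) (hp1 : p ≤ 1) (ha : 0 ≤ a) (hab : a ≤ b) :
    a ≤ a ^ p * b ^ (1 - p) := by
  calc a = a ^ p * a ^ (1 - p) := by
        rw [← rpow_add_of_nonneg ha hp0.le (by linarith), add_sub_cancel, rpow_one]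
    _ ≤ _ := by gcongr

lemma rpow_le_of_quarter (q : ℝ) {s t : ℝ} (ht : 0 < t) (h1 : t / 4 < s) (h2 : s < t / 2) :
    s ^ q ≤ 4 ^ |q| * t ^ q := by
  have hs : 0 < s := by linarith
  rcases le_or_gt 0 q with hq | hq
  · rw [abs_of_nonneg hq, ← mul_rpow (by norm_num) ht.le]
    exact rpow_le_rpow hs.le (by linarith) hq
  · rw [abs_of_neg hq, rpow_neg (by norm_num), ← inv_rpow (by norm_num),
      ← mul_rpow (by norm_num) ht.le]
    exact rpow_le_rpow_of_nonpos (by positivity) (by linarith) hq.le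

/-- the normalized kernel of the averaged Poisson estimate -/
def avgKernel (x : Euc n) (t : ℝ) (y : Euc n) : ℝ :=
  t ^ ((n : ℝ) + 1) * ‖pt (x - y) (t / 2)‖ ^ (-((n : ℝ) + 1))

lemma avgKernel_le {x y : Euc n} {t c : ℝ} (ht : 0 < t) (hc : 0 < c)
    (h : c * t ≤ ‖pt (x - y) (t / 2)‖) : avgKernel x t y ≤ c ^ (-((n : ℝ) + 1)) := by
  have h1 : ‖pt (x - y) (t / 2)‖ ^ (-((n : ℝ) + 1)) ≤ (c * t) ^ (-((n : ℝ) + 1)) :=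
    rpow_le_rpow_of_nonpos (by positivity) h (by linarith)
  calc avgKernel x t y ≤ t ^ ((n : ℝ) + 1) * (c * t) ^ (-((n : ℝ) + 1)) :=
        mul_le_mul_of_nonneg_left h1 (by positivity)
    _ = c ^ (-((n : ℝ) + 1)) := by
        rw [mul_rpow hc.le ht.le, mul_left_comm, ← rpow_add ht, add_neg_cancel, rpow_zero, mul_one]

lemma avgKernel_le_const (x y : Euc n) {t : ℝ} (ht : 0 < t) :
    avgKernel x t y ≤ (1 / 2) ^ (-((n : ℝ) + 1)) := by
  refine avgKernel_le ht (by norm_num) ?_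
  have := abs_tp_le_norm (pt (x - y) (t / 2))
  rw [tp_pt] at this
  linarith [le_abs_self (t / 2)]

lemma norm_pt_mono (x : Euc n) {u v : ℝ} (hu : 0 ≤ u) (huv : u ≤ v) : ‖pt x u‖ ≤ ‖pt x v‖ := by
  refine (sq_le_sq₀ (norm_nonneg _) (norm_nonneg _)).1 ?_
  rw [norm_pt_sq, norm_pt_sq]
  gcongr

lemma slice_pointwise (hM : GrowthBound g lam M) (hp0 : 0 < p) (hp1 : p ≤ 1)
    (hlam : lam * p = α + n + 1) (x y : Euc n) {s t : ℝ} (ht : 0 < t)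
    (h1 : t / 4 < s) (h2 : s < t / 2) :
    t ^ lam * |g (pt y s) * poissonFun n (pt (x - y) (t - s))| ≤
      M ^ (1 - p) * cP n * 4 ^ |-α - lam * (1 - p)| * t *
        (|g (pt y s)| ^ p * s ^ α * avgKernel x t y) := by
  have hs : 0 < s := by linarith
  have hts : 0 < t - s := by linarith
  have hc0 := cP_pos n
  have hM0 := hM.nonneg
  have hn : (0 : ℝ) < n + 1 := by positivity
  have hA : |g (pt y s)| ≤ |g (pt y s)| ^ p *
      (M ^ (1 - p) * (s ^ α * (4 ^ |-α - lam * (1 - p)| * t ^ (-α - lam * (1 - p))))) := by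
    have hb := hM (pt y s) (by simpa using hs)
    rw [tp_pt] at hb
    refine (self_le_rpow_mul_rpow hp0 hp1 (abs_nonneg _) hb).trans ?_
    rw [mul_rpow hM0 (by positivity), ← rpow_mul hs.le]
    have e : -lam * (1 - p) = α + (-α - lam * (1 - p)) := by ring
    rw [e, rpow_add hs]
    gcongr
    exact rpow_le_of_quarter _ ht h1 h2
  have hB : |poissonFun n (pt (x - y) (t - s))| ≤
      cP n * (t * (t ^ (-((n : ℝ) + 1)) * avgKernel x t y)) := by
    rw [abs_of_pos (poissonFun_pos (by simpa using hts)), poissonFun_eq, tp_pt, avgKernel,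
      ← mul_assoc (t ^ (-((n : ℝ) + 1))), ← rpow_add ht, neg_add_cancel, rpow_zero, one_mul]
    have h3 : 0 < ‖pt (x - y) (t / 2)‖ :=
      norm_pos_iff.2 (ne_zero_of_tp_pos (by simpa using ht))
    have h4 : ‖pt (x - y) (t - s)‖ ^ (-((n : ℝ) + 1)) ≤
        ‖pt (x - y) (t / 2)‖ ^ (-((n : ℝ) + 1)) :=
      rpow_le_rpow_of_nonpos h3 (norm_pt_mono _ (by linarith) (by linarith)) (by linarith)
    gcongr
    linarith
  have hk0 : 0 ≤ avgKernel x t y := by unfold avgKernel; positivity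
  have e2 : t ^ lam * (t ^ (-α - lam * (1 - p)) * t ^ (-((n : ℝ) + 1))) = 1 := by
    rw [← rpow_add ht, ← rpow_add ht]
    have : lam + (-α - lam * (1 - p) + -((n : ℝ) + 1)) = 0 := by linear_combination hlam
    rw [this, rpow_zero]
  rw [abs_mul]
  calc t ^ lam * (|g (pt y s)| * |poissonFun n (pt (x - y) (t - s))|)
      ≤ t ^ lam * ((|g (pt y s)| ^ p * (M ^ (1 - p) * (s ^ α * (4 ^ |-α - lam * (1 - p)| *
          t ^ (-α - lam * (1 - p)))))) * (cP n * (t * (t ^ (-((n : ℝ) + 1)) *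
          avgKernel x t y)))) := by gcongr
    _ = _ := by
      linear_combination (M ^ (1 - p) * cP n * 4 ^ |-α - lam * (1 - p)| * t *
        (|g (pt y s)| ^ p * s ^ α * avgKernel x t y)) * e2

lemma slice_estimate (hg : HarmonicOnE g (upperHS n)) (hl : 0 < lam) (hM : GrowthBound g lam M)
    (hp0 : 0 < p) (hp1 : p ≤ 1) (hlam : lam * p = α + n + 1) (x : Euc n) {s t : ℝ} (ht : 0 < t)
    (h1 : t / 4 < s) (h2 : s < t / 2) :
    ENNReal.ofReal (poissonMass n * (t ^ lam * |g (pt x t)|)) ≤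
      ENNReal.ofReal (M ^ (1 - p) * cP n * 4 ^ |-α - lam * (1 - p)| * t) * ∫⁻ y : Euc n,
        ENNReal.ofReal (|g (pt y s)| ^ p) * ENNReal.ofReal (s ^ α) *
          ENNReal.ofReal (avgKernel x t y) := by
  have hs : 0 < s := by linarith
  have hκ := poissonMass_pos n
  have hc0 := cP_pos n
  have hM0 := hM.nonneg
  have h := poisson_semigroup hg hs (hM.le_of_le hl hs) (z := pt x (t - s)) (by simp; linarith)
  rw [pt_add, add_zero, sub_add_cancel] at h
  have e1 : poissonMass n * (t ^ lam * |g (pt x t)|) = t ^ lam *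
      ‖∫ y : Euc n, g (pt y s) * poissonFun n (pt x (t - s) - pt y 0)‖ := by
    rw [h, norm_mul, Real.norm_of_nonneg hκ.le, Real.norm_eq_abs]
    ring
  rw [e1, ENNReal.ofReal_mul (by positivity), ofReal_norm,
    ← lintegral_const_mul' _ _ ENNReal.ofReal_ne_top]
  calc _ ≤ ENNReal.ofReal (t ^ lam) * ∫⁻ y : Euc n,
        ‖g (pt y s) * poissonFun n (pt x (t - s) - pt y 0)‖ₑ := by
        gcongr
        exact enorm_integral_le_lintegral_enorm _
    _ = ∫⁻ y : Euc n, ENNReal.ofReal (t ^ lam) *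
        ‖g (pt y s) * poissonFun n (pt x (t - s) - pt y 0)‖ₑ :=
      (lintegral_const_mul' _ _ ENNReal.ofReal_ne_top).symm
    _ ≤ _ := lintegral_mono fun y => by
      rw [← ofReal_norm, ← ENNReal.ofReal_mul (by positivity),
        ← ENNReal.ofReal_mul (by positivity), ← ENNReal.ofReal_mul (by positivity),
        ← ENNReal.ofReal_mul (by positivity), pt_sub, sub_zero]
      exact ENNReal.ofReal_le_ofReal (slice_pointwise hM hp0 hp1 hlam x y ht h1 h2)

/-- A weighted sub-mean value estimate over the strip `t/4 < s < t/2`. -/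
lemma exists_strip_estimate (hg : HarmonicOnE g (upperHS n)) (hl : 0 < lam)
    (hM : GrowthBound g lam M) (hp0 : 0 < p) (hp1 : p ≤ 1) (hlam : lam * p = α + n + 1) :
    ∃ A : ℝ, 0 < A ∧ ∀ (x : Euc n) (t : ℝ), 0 < t → ENNReal.ofReal (t ^ lam * |g (pt x t)|) ≤
      ENNReal.ofReal A * ∫⁻ w : Euc n × ℝ in univ ×ˢ Ioo (t / 4) (t / 2),
        ENNReal.ofReal (|g (pt w.1 w.2)| ^ p) * ENNReal.ofReal (w.2 ^ α) *
          ENNReal.ofReal (avgKernel x t w.1) ∂(halfVol n) := by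
  have hκ := poissonMass_pos n
  have hc0 := cP_pos n
  have hM0 := hM.nonneg
  set B := M ^ (1 - p) * cP n * 4 ^ |-α - lam * (1 - p)| with hB
  have hB0 : 0 ≤ B := by positivity
  refine ⟨(poissonMass n)⁻¹ * (4 * B) + 1, by positivity, fun x t ht => ?_⟩
  set F : Euc n × ℝ → ℝ≥0∞ := fun w =>
    ENNReal.ofReal (|g (pt w.1 w.2)| ^ p) * ENNReal.ofReal (w.2 ^ α) *
          ENNReal.ofReal (avgKernel x t w.1) with hF
  have hFm : AEMeasurable F (halfVol n) := by
    have hk : Measurable fun w : Euc n × ℝ => avgKernel x t w.1 := by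
      have hc : Continuous fun w : Euc n × ℝ => pt (x - w.1) (t / 2) := by fun_prop
      exact (hc.norm.measurable.pow_const _).const_mul _
    exact ((((aestronglyMeasurable_halfVol hg).aemeasurable.abs.pow_const p).ennreal_ofReal).mul
      (measurable_snd.pow_const _).ennreal_ofReal.aemeasurable).mul hk.ennreal_ofReal.aemeasurable
  have hvol : (halfVol n).restrict (univ ×ˢ Ioo (t / 4) (t / 2)) =
      (volume : Measure (Euc n)).prod ((volume : Measure ℝ).restrict (Ioo (t / 4) (t / 2))) := by
    rw [← Measure.prod_restrict, Measure.restrict_univ, Measure.restrict_restrict_of_subset]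
    intro s hs
    have := hs.1
    have : 0 < s := by linarith
    exact this
  have hint : ∫⁻ w in univ ×ˢ Ioo (t / 4) (t / 2), F w ∂(halfVol n)
      = ∫⁻ s in Ioo (t / 4) (t / 2), ∫⁻ y : Euc n, F (y, s) := by
    have hFm' := hFm.mono_measure (Measure.restrict_le_self (s := univ ×ˢ Ioo (t / 4) (t / 2)))
    rw [hvol] at hFm' ⊢
    exact lintegral_prod_symm _ hFm'
  have hmain : ENNReal.ofReal (poissonMass n * (t ^ lam * |g (pt x t)|)) * ENNReal.ofReal (t / 4)
      ≤ ENNReal.ofReal (B * t) * ∫⁻ w in univ ×ˢ Ioo (t / 4) (t / 2), F w ∂(halfVol n) := by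
    rw [hint, ← lintegral_const_mul' _ _ ENNReal.ofReal_ne_top]
    have e : ENNReal.ofReal (poissonMass n * (t ^ lam * |g (pt x t)|)) * ENNReal.ofReal (t / 4)
        = ∫⁻ s in Ioo (t / 4) (t / 2),
          ENNReal.ofReal (poissonMass n * (t ^ lam * |g (pt x t)|)) := by
      rw [setLIntegral_const, Real.volume_Ioo]
      congr 2
      ring
    rw [e]
    refine setLIntegral_mono' measurableSet_Ioo fun s hs => ?_
    exact slice_estimate hg hl hM hp0 hp1 hlam x ht hs.1 hs.2
  set J := ∫⁻ w in univ ×ˢ Ioo (t / 4) (t / 2), F w ∂(halfVol n) with hJ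
  have e1 : ENNReal.ofReal (t ^ lam * |g (pt x t)|) =
      ENNReal.ofReal ((poissonMass n)⁻¹ * (t / 4)⁻¹) *
      (ENNReal.ofReal (poissonMass n * (t ^ lam * |g (pt x t)|)) * ENNReal.ofReal (t / 4)) := by
    rw [← ENNReal.ofReal_mul (by positivity), ← ENNReal.ofReal_mul (by positivity)]
    congr 1
    field_simp
  have e2 : ENNReal.ofReal ((poissonMass n)⁻¹ * (t / 4)⁻¹) * (ENNReal.ofReal (B * t) * J) =
      ENNReal.ofReal ((poissonMass n)⁻¹ * (4 * B)) * J := by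
    rw [← mul_assoc, ← ENNReal.ofReal_mul (by positivity)]
    congr 2
    field_simp
  rw [e1]
  calc _ ≤ ENNReal.ofReal ((poissonMass n)⁻¹ * (t / 4)⁻¹) * (ENNReal.ofReal (B * t) * J) := by
        gcongr
    _ ≤ _ := by
        rw [e2]
        gcongr
        linarith

end Decay

section LowerBound

variable {n : ℕ} {f g : Euc (n + 1) → ℝ} {lam M p α : ℝ}

/-- the box `‖x‖ ≤ R`, `1/R ≤ t ≤ R` in the half space -/
def box (n : ℕ) (R : ℝ) : Set (Euc n × ℝ) := Metric.closedBall 0 R ×ˢ Icc R⁻¹ R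

lemma measurableSet_box (R : ℝ) : MeasurableSet (box n R) :=
  Metric.isClosed_closedBall.measurableSet.prod measurableSet_Icc

lemma mem_box {R : ℝ} {w : Euc n × ℝ} : w ∈ box n R ↔ ‖w.1‖ ≤ R ∧ R⁻¹ ≤ w.2 ∧ w.2 ≤ R := by
  simp [box]

lemma box_mono {R S : ℝ} (hR : 0 < R) (h : R ≤ S) : box n R ⊆ box n S := by
  intro w hw
  rw [mem_box] at hw ⊢
  exact ⟨hw.1.trans h, (inv_anti₀ hR h).trans hw.2.1, hw.2.2.trans h⟩

lemma exists_lintegral_compl_box_le {H : Euc n × ℝ → ℝ≥0∞} (hH : ∫⁻ w, H w ∂(halfVol n) < ⊤)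
    {τ : ℝ≥0∞} (hτ : 0 < τ) : ∃ k : ℝ, 1 ≤ k ∧ ∫⁻ w in (box n k)ᶜ, H w ∂(halfVol n) ≤ τ := by
  set ν := (halfVol n).withDensity H with hν
  have hms : ∀ k : ℕ, MeasurableSet (box n ((k : ℝ) + 1))ᶜ := fun k => (measurableSet_box _).compl
  have hfin : ∀ s, ν s ≠ ⊤ := fun s =>
    ((measure_mono (subset_univ s)).trans_lt (by
      rwa [hν, withDensity_apply _ MeasurableSet.univ, Measure.restrict_univ])).ne
  have hanti : Antitone fun k : ℕ => (box n ((k : ℝ) + 1))ᶜ := fun i j hij =>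
    compl_subset_compl.2 (box_mono (by positivity) (by gcongr))
  have h := tendsto_measure_iInter_atTop (μ := ν) (fun k => (hms k).nullMeasurableSet) hanti
    ⟨0, hfin _⟩
  have h0 : ν (⋂ k : ℕ, (box n ((k : ℝ) + 1))ᶜ) = 0 := by
    refine withDensity_absolutelyContinuous _ _ ?_
    have hae := ae_halfVol_pos (n := n)
    rw [ae_iff] at hae
    refine measure_mono_null (fun w hw => ?_) hae
    rw [Set.mem_ofPred_eq]
    intro hw2
    obtain ⟨k, hk⟩ := exists_nat_ge (max ‖w.1‖ (max w.2 w.2⁻¹))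
    rw [max_le_iff, max_le_iff] at hk
    refine mem_iInter.1 hw k (mem_box.2 ⟨by linarith, ?_, by linarith⟩)
    exact inv_le_of_inv_le₀ hw2 (by linarith)
  rw [h0] at h
  obtain ⟨k, hk⟩ := (h.eventually (ge_mem_nhds hτ)).exists
  refine ⟨(k : ℝ) + 1, by linarith [k.cast_nonneg (α := ℝ)], ?_⟩
  rwa [Function.comp_apply, hν, withDensity_apply _ (hms k)] at hk

/-- Functions in the Bergman space that obey a growth bound lie in the little-oh growth space. -/
lemma exists_mem_box_of_le (hg : memAp n g p α) (hl : 0 < lam) (hM : GrowthBound g lam M)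
    (hp0 : 0 < p) (hp1 : p ≤ 1) (hlam : lam * p = α + n + 1) {η : ℝ} (hη : 0 < η) :
    ∃ R : ℝ, 1 ≤ R ∧ ∀ (x : Euc n) (t : ℝ), 0 < t → η ≤ t ^ lam * |g (pt x t)| →
      (x, t) ∈ box n R := by
  obtain ⟨A, hA, hst⟩ := exists_strip_estimate hg.1 hl hM hp0 hp1 hlam
  have hT := lintegral_rpow_mul_rpow_lt_top hg
  set H : Euc n × ℝ → ℝ≥0∞ := fun w =>
    ENNReal.ofReal (|g (pt w.1 w.2)| ^ p) * ENNReal.ofReal (w.2 ^ α) with hH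
  set T := (∫⁻ w, H w ∂(halfVol n)).toReal with hTdef
  have hT0 : 0 ≤ T := ENNReal.toReal_nonneg
  have hTe : ∫⁻ w, H w ∂(halfVol n) = ENNReal.ofReal T := (ENNReal.ofReal_toReal hT.ne).symm
  set K : ℝ := (1 / 2) ^ (-((n : ℝ) + 1)) with hK
  have hK0 : 0 < K := by positivity
  obtain ⟨k, hk1, hk⟩ := exists_lintegral_compl_box_le hT
    (τ := ENNReal.ofReal (η / (3 * A * K))) (by simpa using by positivity)
  set κ : ℝ := η / (3 * A * (T + 1)) with hκ
  have hκ0 : 0 < κ := by positivity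
  set c : ℝ := κ ^ (-(1 / ((n : ℝ) + 1))) with hc
  have hc0 : 0 < c := by positivity
  have hcκ : c ^ (-((n : ℝ) + 1)) = κ := by
    rw [hc, ← rpow_mul hκ0.le]
    have : -(1 / ((n : ℝ) + 1)) * -((n : ℝ) + 1) = 1 := by field_simp
    rw [this, rpow_one]
  refine ⟨4 * k + 4 * k * c, by nlinarith [mul_pos (one_pos.trans_le hk1) hc0],
    fun x t ht hηt => ?_⟩
  by_contra hbox
  have hkc : 0 < 4 * k * c := by positivity
  have hav : ∀ w : Euc n × ℝ, w ∈ box n k → w.2 ∈ Ioo (t / 4) (t / 2) →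
      avgKernel x t w.1 ≤ κ := by
    intro w hw hw2
    rw [mem_box] at hw
    have h1 : t ≤ 4 * k := by linarith [hw2.1, hw.2.2]
    have h2 : (4 * k + 4 * k * c)⁻¹ ≤ t := by
      have : (4 * k + 4 * k * c)⁻¹ ≤ k⁻¹ := inv_anti₀ (by positivity) (by linarith)
      linarith [hw2.2, hw.2.1]
    have h3 : 4 * k + 4 * k * c < ‖x‖ := by
      by_contra! h3
      exact hbox (mem_box.2 ⟨h3, h2, by linarith⟩)
    rw [← hcκ]
    refine avgKernel_le ht hc0 ?_
    have h4 := norm_le_norm_pt (x - w.1) (t / 2)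
    have h5 := norm_sub_norm_le x w.1
    have h6 : c * t ≤ c * (4 * k) := by gcongr
    linarith [hw.1]
  have hbd : ∫⁻ w : Euc n × ℝ in univ ×ˢ Ioo (t / 4) (t / 2),
      H w * ENNReal.ofReal (avgKernel x t w.1) ∂(halfVol n) ≤
      ENNReal.ofReal (η / (3 * A * K)) * ENNReal.ofReal K + ENNReal.ofReal T * ENNReal.ofReal κ := by
    rw [← lintegral_inter_add_sdiff _ (univ ×ˢ Ioo (t / 4) (t / 2)) (measurableSet_box k),
      add_comm]
    refine add_le_add ?_ ?_
    · calc _ ≤ ∫⁻ w : Euc n × ℝ in (box n k)ᶜ, H w * ENNReal.ofReal K ∂(halfVol n) := by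
            refine (lintegral_mono fun w => ?_).trans (lintegral_mono_set fun w hw => hw.2)
            gcongr
            exact avgKernel_le_const x w.1 ht
        _ ≤ _ := by
            rw [lintegral_mul_const' _ _ ENNReal.ofReal_ne_top]
            gcongr
    · calc _ ≤ ∫⁻ w : Euc n × ℝ in (univ ×ˢ Ioo (t / 4) (t / 2)) ∩ box n k,
            H w * ENNReal.ofReal κ ∂(halfVol n) := by
            refine setLIntegral_mono' ((MeasurableSet.univ.prod measurableSet_Ioo).inter
              (measurableSet_box k)) fun w hw => ?_
            gcongr
            exact hav w hw.2 hw.1.2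
        _ ≤ _ := by
            rw [lintegral_mul_const' _ _ ENNReal.ofReal_ne_top, ← hTe]
            gcongr
            exact Measure.restrict_le_self
  have hfin := (ENNReal.ofReal_le_ofReal hηt).trans ((hst x t ht).trans (mul_le_mul_right hbd _))
  rw [← ENNReal.ofReal_mul (by positivity), ← ENNReal.ofReal_mul hT0,
    ← ENNReal.ofReal_add (by positivity) (by positivity), ← ENNReal.ofReal_mul hA.le,
    ENNReal.ofReal_le_ofReal_iff (by positivity)] at hfin
  have e : A * (η / (3 * A * K) * K + T * κ) = η / 3 + η / 3 * (T / (T + 1)) := by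
    rw [hκ]
    field_simp
  have h7 : T / (T + 1) ≤ 1 := by
    rw [div_le_one (by positivity)]
    linarith
  have h8 : η / 3 * (T / (T + 1)) ≤ η / 3 := mul_le_of_le_one_right (by positivity) h7
  linarith

lemma exists_Qker_mul_rpow_le (n m : ℕ) (q : ℝ) {R : ℝ} (hR : 1 ≤ R) :
    ∃ C : ℝ, 0 ≤ C ∧ ∀ (x : Euc n) (t : ℝ), 0 < t → ∀ w ∈ box n R,
      |Qker n m x t w.1 w.2| * w.2 ^ q ≤ C * (1 + ‖x‖ + t) ^ (-((n : ℝ) + (m + 1))) := by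
  obtain ⟨C, hC, hb⟩ := (isHomog_poissonDeriv n (m + 1)).bound
  have hR0 : 0 < R := one_pos.trans_le hR
  refine ⟨|(-2 : ℝ) ^ (m + 1) / (Nat.factorial m : ℝ)| * C *
    (2 + R + R ^ 2) ^ ((n : ℝ) + (m + 1)) * R ^ |q|, by positivity, fun x t ht w hw => ?_⟩
  rw [mem_box] at hw
  have hw2 : 0 < w.2 := (inv_pos.2 hR0).trans_le hw.2.1
  have hb' := hb _ (ne_zero_of_pos (x := x) ht hw2)
  rw [Qker_eq m x w.1 (by positivity), abs_mul]
  rw [Real.norm_eq_abs] at hb'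
  push_cast at hb'
  set d := ‖pt x t - pt w.1 (-w.2)‖ with hd
  have hd0 : 0 < d := norm_pos_iff.2 (ne_zero_of_pos ht hw2)
  have hd1 : t + R⁻¹ ≤ d := by
    have := abs_tp_le_norm (pt x t - pt w.1 (-w.2))
    rw [tp_sub, tp_pt, tp_pt] at this
    linarith [le_abs_self (t - -w.2), hw.2.1]
  have hd2 : ‖x‖ - R ≤ d := by
    have h1 := norm_le_norm_pt (x - w.1) (t - -w.2)
    rw [← pt_sub] at h1
    linarith [norm_sub_norm_le x w.1, hw.1]
  have hd3 : 1 + ‖x‖ + t ≤ (2 + R + R ^ 2) * d := by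
    have h1 : 1 ≤ R * d := by
      have : R * R⁻¹ ≤ R * d := by gcongr; linarith
      rwa [mul_inv_cancel₀ hR0.ne'] at this
    have h2 : R * 1 ≤ R * (R * d) := by gcongr
    have h3 : 0 < R⁻¹ := by positivity
    nlinarith
  have hd4 : d ^ (-((n : ℝ) + (m + 1))) ≤
      (2 + R + R ^ 2) ^ ((n : ℝ) + (m + 1)) * (1 + ‖x‖ + t) ^ (-((n : ℝ) + (m + 1))) := by
    have h1 : ((2 + R + R ^ 2) * d) ^ (-((n : ℝ) + (m + 1))) ≤
        (1 + ‖x‖ + t) ^ (-((n : ℝ) + (m + 1))) :=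
      rpow_le_rpow_of_nonpos (by positivity) hd3 (by rw [neg_nonpos]; positivity)
    rw [mul_rpow (by positivity) hd0.le, rpow_neg (by positivity)] at h1
    rwa [inv_mul_le_iff₀ (by positivity)] at h1
  have hq : w.2 ^ q ≤ R ^ |q| := by
    rcases le_or_gt 0 q with h | h
    · rw [abs_of_nonneg h]
      exact rpow_le_rpow hw2.le hw.2.2 h
    · rw [abs_of_neg h, rpow_neg hR0.le, ← inv_rpow hR0.le]
      exact rpow_le_rpow_of_nonpos (by positivity) hw.2.1 h.le
  calc _ ≤ |(-2 : ℝ) ^ (m + 1) / (Nat.factorial m : ℝ)| * (C * ((2 + R + R ^ 2) ^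
        ((n : ℝ) + (m + 1)) * (1 + ‖x‖ + t) ^ (-((n : ℝ) + (m + 1))))) * R ^ |q| := by
        gcongr
        exact hb'.trans (by gcongr)
    _ = _ := by ring

lemma distTwoInt_lt_top (m : ℕ) (hp : 0 < p) (hα : -1 < α) (hlam : lam * p = α + n + 1)
    (hm : lam - 1 < m) {ε R : ℝ} (hR : 1 ≤ R) (hV : Vset n f lam ε ⊆ box n R) :
    distTwoInt n m f lam α p ε < ⊤ := by
  obtain ⟨C, hC, hb⟩ := exists_Qker_mul_rpow_le n m ((m : ℝ) - lam) hR
  set v := ((volume : Measure (Euc n)).prod (volume : Measure ℝ)) (box n R) with hv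
  have hvt : v < ⊤ := by
    rw [hv, box, Measure.prod_prod]
    exact ENNReal.mul_lt_top measure_closedBall_lt_top measure_Icc_lt_top
  have hexp : (n : ℝ) + 1 + α < ((n : ℝ) + (m + 1)) * p := by
    nlinarith [n.cast_nonneg (α := ℝ)]
  have hI := lintegral_one_add_lt_top (n := n) hα hexp
  have hpt : ∀ z ∈ (univ : Set (Euc n)) ×ˢ Ioi (0 : ℝ),
      (∫⁻ w : Euc n × ℝ in Vset n f lam ε,
        ENNReal.ofReal (|Qker n m z.1 z.2 w.1 w.2| * w.2 ^ ((m : ℝ) - lam))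
        ∂((volume : Measure (Euc n)).prod (volume : Measure ℝ))) ^ p * ENNReal.ofReal (z.2 ^ α) ≤
      (ENNReal.ofReal C * v) ^ p *
        (ENNReal.ofReal ((1 + ‖z.1‖ + z.2) ^ (-(((n : ℝ) + (m + 1)) * p))) *
          ENNReal.ofReal (z.2 ^ α)) := by
    intro z hz
    have hz2 : 0 < z.2 := hz.2
    have hb0 : 0 < 1 + ‖z.1‖ + z.2 := by positivity
    have h1 : ∫⁻ w : Euc n × ℝ in Vset n f lam ε,
        ENNReal.ofReal (|Qker n m z.1 z.2 w.1 w.2| * w.2 ^ ((m : ℝ) - lam))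
        ∂((volume : Measure (Euc n)).prod (volume : Measure ℝ)) ≤
        ENNReal.ofReal C * v * ENNReal.ofReal ((1 + ‖z.1‖ + z.2) ^ (-((n : ℝ) + (m + 1)))) := by
      calc _ ≤ _ := lintegral_mono_set hV
        _ ≤ ∫⁻ _ in box n R, ENNReal.ofReal (C * (1 + ‖z.1‖ + z.2) ^ (-((n : ℝ) + (m + 1))))
            ∂((volume : Measure (Euc n)).prod (volume : Measure ℝ)) :=
          setLIntegral_mono' (measurableSet_box R) fun w hw =>
            ENNReal.ofReal_le_ofReal (hb z.1 z.2 hz2 w hw)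
        _ = _ := by
          rw [setLIntegral_const, ENNReal.ofReal_mul hC, ← hv]
          ring
    rw [← mul_assoc]
    gcongr
    refine (ENNReal.rpow_le_rpow h1 hp.le).trans_eq ?_
    rw [ENNReal.mul_rpow_of_nonneg _ _ hp.le, ENNReal.ofReal_rpow_of_nonneg (by positivity) hp.le,
      ← rpow_mul hb0.le, neg_mul]
  have hfin : (ENNReal.ofReal C * v) ^ p < ⊤ :=
    ENNReal.rpow_lt_top_of_nonneg hp.le (ENNReal.mul_lt_top ENNReal.ofReal_lt_top hvt).ne
  rw [distTwoInt]
  refine (setLIntegral_mono' (MeasurableSet.univ.prod measurableSet_Ioi) hpt).trans_lt ?_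
  rw [lintegral_const_mul' _ _ hfin.ne, ← halfVol_eq]
  exact ENNReal.mul_lt_top hfin hI

lemma distTwo_le_supNormE_sub (m : ℕ) (hf : supNormE n f lam < ⊤) (hg : memAp n g p α)
    (hl : 0 < lam) (hp0 : 0 < p) (hp1 : p ≤ 1) (hα : -1 < α) (hlam : lam * p = α + n + 1)
    (hm : lam - 1 < m) :
    distTwo n m f lam α p ≤ supNormE n (fun z => f z - g z) lam := by
  rcases eq_or_ne (supNormE n (fun z => f z - g z) lam) ⊤ with htop | htop
  · rw [htop]
    exact le_top
  have hMf := growthBound_of_supNormE_lt_top hf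
  have hMd := growthBound_of_supNormE_lt_top htop.lt_top
  set Mf := (supNormE n f lam).toReal
  set δ := (supNormE n (fun z => f z - g z) lam).toReal with hδ
  have hδ0 : 0 ≤ δ := ENNReal.toReal_nonneg
  have hMg : GrowthBound g lam (Mf + δ) := by
    intro z hz
    have h1 := hMf z hz
    have h2 := hMd z hz
    have h3 : |g z| ≤ |f z| + |f z - g z| := by
      have := abs_sub (f z) (f z - g z)
      rwa [sub_sub_cancel] at this
    rw [add_mul]
    linarith
  rw [← ENNReal.ofReal_toReal htop, ← hδ]
  refine ENNReal.le_of_forall_pos_le_add fun e he _ => ?_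
  have he' : (0 : ℝ) < e := he
  obtain ⟨R, hR, hbox⟩ := exists_mem_box_of_le hg hl hMg hp0 hp1 hlam he'
  have hV : Vset n f lam (δ + e) ⊆ box n R := by
    rintro ⟨y, s⟩ ⟨hs, hys⟩
    refine hbox y s hs ?_
    have h2 := hMd (pt y s) (by simpa using hs)
    have h3 := abs_sub_abs_le_abs_sub (f (pt y s)) (g (pt y s))
    dsimp only at hs hys h2
    rw [tp_pt] at h2
    have h4 : |f (pt y s)| * s ^ lam ≤ (|g (pt y s)| + δ * s ^ (-lam)) * s ^ lam := by
      gcongr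
      linarith
    have h5 : s ^ (-lam) * s ^ lam = 1 := by rw [← rpow_add hs, neg_add_cancel, rpow_zero]
    have h6 : (|g (pt y s)| + δ * s ^ (-lam)) * s ^ lam = s ^ lam * |g (pt y s)| + δ := by
      linear_combination δ * h5
    linarith
  have h := distTwoInt_lt_top m hp0 hα hlam hm hR hV
  calc distTwo n m f lam α p ≤ ENNReal.ofReal (δ + e) :=
        iInf₂_le (δ + e) ⟨by positivity, h⟩
    _ = _ := by rw [ENNReal.ofReal_add hδ0 he'.le, ENNReal.ofReal_coe_nnreal]

end LowerBound

/-- the distance formula dist_{A^∞_λ}(f, A^p_α) ≍ d₂(f). -/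
theorem stmt9 (n : ℕ) (hn : 1 ≤ n) (p α lam : ℝ) (hp0 : 0 < p) (hp1 : p ≤ 1)
    (hα : -1 < α) (hlam : lam = (α + (n : ℝ) + 1) / p)
    (m : ℕ) (hm : max (lam - 1) (α / p) < (m : ℝ)) :
    ∃ c C : ℝ, 0 < c ∧ 0 < C ∧ ∀ f : Euc (n + 1) → ℝ,
      HarmonicOnE f (upperHS n) → supNormE n f lam < ⊤ →
      ENNReal.ofReal c * distTwo n m f lam α p ≤ distOne n p α lam f ∧
      distOne n p α lam f ≤ ENNReal.ofReal C * distTwo n m f lam α p := by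
  have hl : 0 < lam := by
    rw [hlam]
    have : (0 : ℝ) ≤ n := n.cast_nonneg
    exact div_pos (by linarith) hp0
  have hlp : lam * p = α + n + 1 := by rw [hlam, div_mul_cancel₀ _ hp0.ne']
  have hm1 := (max_lt_iff.1 hm).1
  obtain ⟨C, hC, h⟩ := exists_distOne_le n m hl hm1 (α := α) hp0
  refine ⟨1, C, one_pos, hC, fun f hf hfin => ⟨?_, h f hf hfin⟩⟩
  rw [ENNReal.ofReal_one, one_mul]
  exact le_iInf₂ fun g hg => distTwo_le_supNormE_sub m hfin hg hl hp0 hp1 hα hlp hm1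

end
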